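/- arXiv:1112.3193 — 10 statements merged into one kernel-verified Lean document; each statement's English description precedes it below -/
import Mathlib

section
/- Let T be a finite tree and let x be an eigenvector of T for the eigenvalue λ such that x has no zero entries (x(v) ≠ 0 for every vertex v). Then λ has multiplicity one, i.e., the eigenspace {y ∈ ℝ^{V(T)} : A y = λ y} of the adjacency matrix A of T is one-dimensional. -/
open SimpleGraph

open scoped Classical

/-- The real adjacency matrix of a simple graph. -/
noncomputable def adjMat {V : Type*} (G : SimpleGraph V) : Matrix V V ℝ :=
  fun u v => if G.Adj u v then 1 else 0

/-- The eigenspace `{x : A x = μ x}` of the adjacency matrix of `G`. -/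
noncomputable def eigSpace {V : Type*} [Fintype V] (G : SimpleGraph V) (μ : ℝ) :
    Submodule ℝ (V → ℝ) :=
  LinearMap.ker ((adjMat G).mulVecLin - μ • LinearMap.id)

/-- `x` is an eigenvector of `G` for eigenvalue `μ`. -/
def IsEigenvector {V : Type*} [Fintype V] (G : SimpleGraph V) (μ : ℝ) (x : V → ℝ) : Prop :=
  x ≠ 0 ∧ (adjMat G).mulVec x = μ • x

/-- `N_μ(G)`: vertices on which every eigenvector of `G` for `μ` vanishes. -/
def nSet {V : Type*} [Fintype V] (G : SimpleGraph V) (μ : ℝ) : Set V :=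
  {v | ∀ x : V → ℝ, IsEigenvector G μ x → x v = 0}

/-- `N^C_μ(G)`: vertices of `N_μ(G)` with a neighbor outside `N_μ(G)`. -/
def ncSet {V : Type*} [Fintype V] (G : SimpleGraph V) (μ : ℝ) : Set V :=
  {v | v ∈ nSet G μ ∧ ∃ w, G.Adj v w ∧ w ∉ nSet G μ}

/-- `C` is the vertex set of a connected component of the induced subgraph `G[S]`. -/
def IsCompOf {V : Type*} (G : SimpleGraph V) (S C : Set V) : Prop :=
  ∃ c : (G.induce S).ConnectedComponent, C = Subtype.val '' c.supp

/-- A divergence-free antisymmetric flow on a finite acyclic graph vanishes on every edge. -/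
theorem SimpleGraph.IsAcyclic.flow_eq_zero {V : Type*} [Fintype V] {G : SimpleGraph V}
    (hG : G.IsAcyclic) (f : V → V → ℝ) (hanti : ∀ a b, f a b = -f b a)
    (hsupp : ∀ a b, ¬ G.Adj a b → f a b = 0) (hdiv : ∀ a, ∑ b, f a b = 0)
    {u v : V} (huv : G.Adj u v) : f u v = 0 := by
  have hbridge := isAcyclic_iff_forall_adj_isBridge.mp hG huv
  rw [isBridge_iff] at hbridge
  set H := G.deleteEdges {s(u, v)}
  set S : Finset V := Finset.univ.filter fun a => H.Reachable u a with hS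
  have huS : u ∈ S := by simp [hS]
  have hvS : v ∉ S := by simpa [hS] using hbridge
  have hcut : ∀ a ∈ S, ∀ b, b ∉ S → f a b ≠ 0 → a = u ∧ b = v := by
    intro a ha b hb hab
    have hadj : G.Adj a b := by
      by_contra h
      exact hab (hsupp a b h)
    simp only [hS, Finset.mem_filter, Finset.mem_univ, true_and] at ha hb
    by_cases he : s(a, b) = s(u, v)
    · rcases Sym2.eq_iff.mp he with h | ⟨rfl, rfl⟩
      · exact h
      · exact absurd (Reachable.refl _) hb
    · exact absurd (ha.trans (Adj.reachable (deleteEdges_adj.mpr ⟨hadj, he⟩))) hb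
  have hinner : ∑ a ∈ S, ∑ b ∈ S, f a b = 0 := by
    have h : ∑ a ∈ S, ∑ b ∈ S, f a b = -∑ a ∈ S, ∑ b ∈ S, f a b := by
      conv_lhs => rw [Finset.sum_comm]
      simp_rw [← Finset.sum_neg_distrib]
      exact Finset.sum_congr rfl fun a _ => Finset.sum_congr rfl fun b _ => hanti b a
    linarith
  have houter : ∑ a ∈ S, ∑ b ∈ Sᶜ, f a b = f u v := by
    rw [Finset.sum_eq_single_of_mem u huS, Finset.sum_eq_single_of_mem v (by simpa using hvS)]
    · intro b hb hbv
      by_contra h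
      exact hbv (hcut u huS b (by simpa using hb) h).2
    · intro a ha hau
      refine Finset.sum_eq_zero fun b hb => ?_
      by_contra h
      exact hau (hcut a ha b (by simpa using hb) h).1
  calc f u v = ∑ a ∈ S, ∑ b ∈ S, f a b + ∑ a ∈ S, ∑ b ∈ Sᶜ, f a b := by
        rw [hinner, houter, zero_add]
    _ = ∑ a ∈ S, ∑ b, f a b := by
        rw [← Finset.sum_add_distrib]
        exact Finset.sum_congr rfl fun a _ => Finset.sum_add_sum_compl S _
    _ = 0 := Finset.sum_eq_zero fun a _ => hdiv a

theorem mem_eigSpace {V : Type*} [Fintype V] {G : SimpleGraph V} {μ : ℝ} {y : V → ℝ} :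
    y ∈ eigSpace G μ ↔ (adjMat G).mulVec y = μ • y := by
  simp [eigSpace, sub_eq_zero]

/-- Two eigenvectors of a finite acyclic graph for the same eigenvalue are proportional along
every edge. -/
theorem SimpleGraph.IsAcyclic.mul_eq_mul_of_adj {V : Type*} [Fintype V] {G : SimpleGraph V}
    (hG : G.IsAcyclic) {μ : ℝ} {x y : V → ℝ} (hx : (adjMat G).mulVec x = μ • x)
    (hy : (adjMat G).mulVec y = μ • y) {u v : V} (huv : G.Adj u v) :
    x u * y v = y u * x v := by
  have key := hG.flow_eq_zero (fun a b => adjMat G a b * (x a * y b - y a * x b))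
    (fun a b => by simp only [adjMat, G.adj_comm a b]; ring)
    (fun a b h => by simp [adjMat, h])
    (fun a => by
      have hxa : ∑ b, adjMat G a b * x b = μ * x a := congrFun hx a
      have hya : ∑ b, adjMat G a b * y b = μ * y a := congrFun hy a
      calc ∑ b, adjMat G a b * (x a * y b - y a * x b)
          = x a * ∑ b, adjMat G a b * y b - y a * ∑ b, adjMat G a b * x b := by
            rw [Finset.mul_sum, Finset.mul_sum, ← Finset.sum_sub_distrib]
            exact Finset.sum_congr rfl fun b _ => by ring
        _ = 0 := by rw [hxa, hya]; ring) huv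
  simpa [adjMat, huv, sub_eq_zero] using key

/-- An eigenvector of a tree with no zero entries forces the eigenvalue to be simple. -/
theorem stmt_0 {V : Type*} [Fintype V] (G : SimpleGraph V) (hT : G.IsTree)
    (μ : ℝ) (x : V → ℝ) (hx : IsEigenvector G μ x) (hnz : ∀ v, x v ≠ 0) :
    Module.finrank ℝ (eigSpace G μ) = 1 := by
  obtain ⟨r⟩ := hT.connected.nonempty
  refine finrank_eq_one (⟨x, mem_eigSpace.mpr hx.2⟩ : eigSpace G μ)
    (fun h => hx.1 (congrArg Subtype.val h)) fun ⟨y, hy⟩ => ⟨y r / x r, Subtype.ext ?_⟩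
  have hratio : ∀ v, y v / x v = y r / x r := by
    intro v
    obtain ⟨p⟩ := hT.connected.preconnected v r
    induction p with
    | nil => rfl
    | cons h _ ih =>
      rw [← ih, div_eq_div_iff (hnz _) (hnz _)]
      linarith [hT.isAcyclic.mul_eq_mul_of_adj hx.2 (mem_eigSpace.mp hy) h]
  funext v
  simp [← hratio v, hnz v]
end

section
/- Let G be a graph and x an eigenvector of G for eigenvalue λ. Let C be a connected component of the induced subgraph G[V(G) \ N_λ(G)]. Then the restriction x|_C is either the zero vector or satisfies A_C (x|_C) = λ (x|_C), where A_C is the adjacency matrix of C. If moreover G is a tree and x|_C ≠ 0, then x|_C has no zero entries and the λ-eigenspace of C is one-dimensional and spanned by x|_C. -/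
open SimpleGraph

open scoped Classical

/-- An antisymmetric function supported on the edges of a finite forest whose sum at every vertex
is zero vanishes identically: there is no nonzero circulation on a forest. -/
theorem circulation_eq_zero_of_isAcyclic {V : Type*} [Fintype V] {G : SimpleGraph V}
    (hG : G.IsAcyclic) (f : V → V → ℝ) (hanti : ∀ a b, f b a = -f a b)
    (hsupp : ∀ a b, ¬ G.Adj a b → f a b = 0) (hsum : ∀ a, ∑ b, f a b = 0) (u v : V) :
    f u v = 0 := by
  by_cases huv : G.Adj u v
  swap
  · exact hsupp u v huv
  have hbridge : ¬ (G.deleteEdges {s(u, v)}).Reachable u v :=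
    isBridge_iff.1 (isAcyclic_iff_forall_adj_isBridge.1 hG huv)
  set H := G.deleteEdges {s(u, v)} with hH
  let S : Finset V := Finset.univ.filter fun a => H.Reachable u a
  have hS : ∀ a, a ∈ S ↔ H.Reachable u a := fun a => by simp [S]
  have hcross : ∀ a ∈ S, ∀ b ∈ Sᶜ, f a b ≠ 0 → a = u ∧ b = v := by
    intro a ha b hb hab
    rw [Finset.mem_compl, hS] at hb
    rw [hS] at ha
    have hadj : G.Adj a b := by
      by_contra h
      exact hab (hsupp a b h)
    have hedge : s(a, b) = s(u, v) := by
      by_contra h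
      have : H.Adj a b := by simp only [hH, deleteEdges_adj]; exact ⟨hadj, h⟩
      exact hb (ha.trans this.reachable)
    rcases Sym2.eq_iff.1 hedge with h | ⟨h, -⟩
    · exact h
    · exact absurd (h ▸ ha) hbridge
  have hinner : ∑ a ∈ S, ∑ b ∈ S, f a b = 0 := by
    have h : ∑ a ∈ S, ∑ b ∈ S, f a b = -∑ a ∈ S, ∑ b ∈ S, f a b := by
      conv_lhs => rw [Finset.sum_comm]
      simp only [← Finset.sum_neg_distrib]
      exact Finset.sum_congr rfl fun a _ => Finset.sum_congr rfl fun b _ => hanti a b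
    linarith
  have houter : ∑ a ∈ S, ∑ b ∈ Sᶜ, f a b = f u v := by
    have huS : u ∈ S := (hS u).2 (Reachable.refl u)
    have hvS : v ∈ Sᶜ := by rw [Finset.mem_compl, hS]; exact hbridge
    rw [Finset.sum_eq_single_of_mem u huS, Finset.sum_eq_single_of_mem v hvS]
    · intro b hb hbv
      by_contra h
      exact hbv (hcross u huS b hb h).2
    · intro a ha hau
      refine Finset.sum_eq_zero fun b hb => ?_
      by_contra h
      exact hau (hcross a ha b hb h).1
  have htotal : ∑ a ∈ S, ∑ b, f a b = 0 := Finset.sum_eq_zero fun a _ => hsum a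
  simp_rw [← Finset.sum_add_sum_compl S, Finset.sum_add_distrib] at htotal
  linarith

theorem adjMat_mulVec_apply {V : Type*} [Fintype V] (G : SimpleGraph V) (x : V → ℝ) (v : V) :
    (adjMat G).mulVec x v = ∑ w, if G.Adj v w then x w else 0 := by
  simp [Matrix.mulVec, dotProduct, adjMat]

theorem mem_eigSpace_iff {V : Type*} [Fintype V] {G : SimpleGraph V} {μ : ℝ} {x : V → ℝ} :
    x ∈ eigSpace G μ ↔ (adjMat G).mulVec x = μ • x := by
  simp [eigSpace, sub_eq_zero]

/-- On a forest, two vectors of the same eigenspace are proportional along every edge. -/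
theorem mul_eq_mul_of_adj_of_isAcyclic {V : Type*} [Fintype V] {G : SimpleGraph V}
    (hG : G.IsAcyclic) {μ : ℝ} {y z : V → ℝ} (hy : (adjMat G).mulVec y = μ • y)
    (hz : (adjMat G).mulVec z = μ • z) {u v : V} (huv : G.Adj u v) :
    z u * y v = z v * y u := by
  have key := circulation_eq_zero_of_isAcyclic hG
    (fun a b => z a * (if G.Adj a b then y b else 0) - y a * (if G.Adj a b then z b else 0))
    (fun a b => by simp only [G.adj_comm b a]; split_ifs <;> ring)
    (fun a b hab => by simp [hab])
    (fun a => by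
      rw [Finset.sum_sub_distrib, ← Finset.mul_sum, ← Finset.mul_sum, ← adjMat_mulVec_apply,
        ← adjMat_mulVec_apply, hy, hz]
      simp only [Pi.smul_apply, smul_eq_mul]
      ring) u v
  simp only [huv, if_true] at key
  linarith

theorem IsCompOf.subset {V : Type*} {G : SimpleGraph V} {S C : Set V} (hC : IsCompOf G S C) :
    C ⊆ S := by
  obtain ⟨c, rfl⟩ := hC
  rintro _ ⟨a, -, rfl⟩
  exact a.2

theorem IsCompOf.mem_of_adj {V : Type*} {G : SimpleGraph V} {S C : Set V} (hC : IsCompOf G S C)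
    {u v : V} (hu : u ∈ C) (hv : v ∈ S) (huv : G.Adj u v) : v ∈ C := by
  obtain ⟨c, rfl⟩ := hC
  obtain ⟨a, ha, rfl⟩ := hu
  exact ⟨⟨v, hv⟩, c.mem_supp_of_adj_mem_supp ha (by simpa using huv), rfl⟩

theorem IsCompOf.preconnected {V : Type*} {G : SimpleGraph V} {S C : Set V}
    (hC : IsCompOf G S C) : (G.induce C).Preconnected := by
  have hmem := fun {u v : V} => hC.mem_of_adj (u := u) (v := v)
  obtain ⟨c, hc⟩ := hC
  have hwalk : ∀ {a b : S}, (G.induce S).Walk a b → ∀ (ha : (a : V) ∈ C) (hb : (b : V) ∈ C),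
      (G.induce C).Reachable ⟨a, ha⟩ ⟨b, hb⟩ := by
    intro a b p
    induction p with
    | nil => exact fun _ _ => Reachable.refl _
    | @cons a a' b h p ih =>
      intro ha hb
      have hadj : G.Adj a a' := by simpa using h
      have ha' := hmem ha a'.2 hadj
      exact Reachable.trans (Adj.reachable (by simpa using hadj)) (ih ha' hb)
  rintro ⟨u, hu⟩ ⟨v, hv⟩
  obtain ⟨a, ha, rfl⟩ := hc ▸ hu
  obtain ⟨b, hb, rfl⟩ := hc ▸ hv
  obtain ⟨p⟩ := ConnectedComponent.exact (ha.trans hb.symm)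
  exact hwalk p hu hv

/-- A predicate preserved along the edges of a preconnected graph holds everywhere once it holds
somewhere. -/
theorem SimpleGraph.Preconnected.forall_of_adj {V : Type*} {G : SimpleGraph V}
    (hG : G.Preconnected) {P : V → Prop} (hP : ∀ a b, G.Adj a b → P a → P b) {u : V} (hu : P u)
    (v : V) : P v := by
  obtain ⟨p⟩ := hG u v
  induction p with
  | nil => exact hu
  | cons h p ih => exact ih (hP _ _ h hu)

/-- On a preconnected forest, a nowhere zero eigenvector spans its eigenspace. -/
theorem eigSpace_eq_span_of_isAcyclic {V : Type*} [Fintype V] {G : SimpleGraph V}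
    (hacyc : G.IsAcyclic) (hconn : G.Preconnected) {μ : ℝ} {y : V → ℝ}
    (hy : (adjMat G).mulVec y = μ • y) (hne : ∀ v, y v ≠ 0) :
    eigSpace G μ = Submodule.span ℝ {y} := by
  apply le_antisymm
  · intro z hz
    rw [mem_eigSpace_iff] at hz
    rw [Submodule.mem_span_singleton]
    rcases isEmpty_or_nonempty V with h | ⟨⟨u⟩⟩
    · exact ⟨0, Subsingleton.elim _ _⟩
    refine ⟨z u / y u, funext fun v => ?_⟩
    refine hconn.forall_of_adj (P := fun w => ((z u / y u) • y) w = z w) (fun a b hab ha => ?_)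
      (u := u) (by simp [hne u]) v
    have h := mul_eq_mul_of_adj_of_isAcyclic hacyc hy hz hab
    simp only [Pi.smul_apply, smul_eq_mul] at ha ⊢
    apply mul_right_cancel₀ (hne a)
    rw [← h, ← ha]
    ring
  · rw [Submodule.span_singleton_le_iff_mem, mem_eigSpace_iff]
    exact hy

/-- The restriction of an eigenvector to a component of the complement of `nSet` satisfies the
eigenvalue equation of the component. -/
theorem adjMat_induce_mulVec_domRestrict {V : Type*} [Fintype V] {G : SimpleGraph V} {μ : ℝ}
    {x : V → ℝ} (hx : IsEigenvector G μ x) {C : Set V} [Fintype C]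
    (hC : IsCompOf G ((nSet G μ)ᶜ) C) :
    (adjMat (G.induce C)).mulVec (C.domRestrict x) = μ • C.domRestrict x := by
  ext v
  have h := congrFun hx.2 v
  rw [adjMat_mulVec_apply] at h
  rw [adjMat_mulVec_apply]
  simp only [Pi.smul_apply, Set.domRestrict_apply, comap_adj, Function.Embedding.subtype_apply] at h ⊢
  rw [← h]
  have hzero : ∀ w ∉ C, (if G.Adj v w then x w else 0) = 0 := by
    intro w hw
    split_ifs with hadj
    · by_contra hxw
      exact hw (hC.mem_of_adj v.2 (fun hN => hxw (hN x hx)) hadj)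
    · rfl
  rw [← Finset.sum_subset (Finset.subset_univ C.toFinset) fun w _ hw => hzero w (by simpa using hw)]
  exact (Finset.sum_subtype C.toFinset (fun _ => Set.mem_toFinset)
    fun w => if G.Adj v w then x w else 0).symm

theorem stmt_2 {V : Type*} [Fintype V] (G : SimpleGraph V) (μ : ℝ) (x : V → ℝ)
    (hx : IsEigenvector G μ x) (C : Set V)
    (hC : IsCompOf G ((nSet G μ)ᶜ) C) :
    (C.restrict x = 0 ∨
        (adjMat (G.induce C)).mulVec (C.restrict x) = μ • C.restrict x) ∧
      (G.IsTree → C.restrict x ≠ 0 →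
        (∀ v : C, x v ≠ 0) ∧
          eigSpace (G.induce C) μ = Submodule.span ℝ {C.restrict x} ∧
            Module.finrank ℝ (eigSpace (G.induce C) μ) = 1) := by
  have hres := adjMat_induce_mulVec_domRestrict hx hC
  refine ⟨Or.inr hres, fun hG hne => ?_⟩
  have hnowhere : ∀ v : C, x v ≠ 0 := by
    obtain ⟨u, hu⟩ := Function.ne_iff.1 hne
    refine hC.preconnected.forall_of_adj (P := fun w : C => x w ≠ 0) (fun a b hab ha hb => ?_) hu
    refine hC.subset b.2 fun y hy => ?_
    have h := mul_eq_mul_of_adj_of_isAcyclic hG.isAcyclic hx.2 hy.2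
      (u := (a : V)) (v := b) (by simpa using hab)
    rw [hb, mul_zero] at h
    exact (mul_eq_zero.1 h.symm).resolve_right ha
  have hspan := eigSpace_eq_span_of_isAcyclic (hG.isAcyclic.induce C) hC.preconnected hres hnowhere
  refine ⟨hnowhere, hspan, ?_⟩
  rw [hspan]
  exact finrank_span_singleton hne
end

section
/- Let T be a tree, λ ∈ ℝ, and let x and x′ be linearly independent eigenvectors of T for eigenvalue λ. Let C be the vertex set of a connected component of T[supp(x)] and C′ the vertex set of a connected component of T[supp(x′)]. Then either C = C′ or C ∩ C′ = ∅. -/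
open SimpleGraph

open scoped Classical

open Finset in
/-- Across a bridge, two solutions of the same eigenvalue equation are proportional. -/
theorem SimpleGraph.IsBridge.mul_eq_mul_of_mulVec_eq_smul {V : Type*} [Fintype V]
    {G : SimpleGraph V} {μ : ℝ} {x y : V → ℝ} {v w : V} (hb : G.IsBridge s(v, w))
    (hvw : G.Adj v w) (hx : (adjMat G).mulVec x = μ • x) (hy : (adjMat G).mulVec y = μ • y) :
    x v * y w = y v * x w := by
  rw [isBridge_iff] at hb
  set H := G.deleteEdges {s(v, w)} with hH
  let χ : V → ℝ := fun u => if H.Reachable v u then 1 else 0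
  let f : V → V → ℝ := fun b u => adjMat G b u * (x b * y u - y b * x u)
  have hrow (b : V) : ∑ u, f b u = 0 := by
    have h1 : ∑ u, adjMat G b u * x u = μ * x b := by
      simpa [Matrix.mulVec, dotProduct] using congrFun hx b
    have h2 : ∑ u, adjMat G b u * y u = μ * y b := by
      simpa [Matrix.mulVec, dotProduct] using congrFun hy b
    calc ∑ u, f b u
        = x b * ∑ u, adjMat G b u * y u - y b * ∑ u, adjMat G b u * x u := by
          rw [mul_sum, mul_sum, ← sum_sub_distrib]
          exact sum_congr rfl fun u _ => by simp only [f]; ring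
      _ = 0 := by rw [h1, h2]; ring
  have hanti (b u : V) : f u b = -f b u := by
    simp only [f, adjMat, G.adj_comm u b]
    ring
  have hinner : ∑ b, ∑ u, χ b * χ u * f b u = 0 := by
    have h : ∑ b, ∑ u, χ b * χ u * f b u = -∑ b, ∑ u, χ b * χ u * f b u := by
      conv_lhs => rw [sum_comm]
      simp only [← sum_neg_distrib]
      refine sum_congr rfl fun b _ => sum_congr rfl fun u _ => ?_
      rw [hanti b u]
      ring
    linarith
  have hcross (b u : V) :
      χ b * (1 - χ u) * f b u = if b = v then (if u = w then f v w else 0) else 0 := by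
    by_cases hbv : b = v ∧ u = w
    · obtain ⟨rfl, rfl⟩ := hbv
      simp [χ, hb]
    · have hrhs : (if b = v then (if u = w then f v w else 0) else 0) = 0 := by
        grind
      rw [hrhs]
      by_cases h1 : H.Reachable v b
      swap
      · simp [χ, h1]
      by_cases h2 : H.Reachable v u
      · simp [χ, h2]
      have hadj : ¬ G.Adj b u := by
        intro hbu
        by_cases he : s(b, u) = s(v, w)
        · rcases Sym2.eq_iff.mp he with h | ⟨rfl, rfl⟩
          · exact hbv h
          · exact hb h1
        · exact h2 (h1.trans (Adj.reachable (by
            rw [hH, deleteEdges_adj]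
            exact ⟨hbu, he⟩)))
      simp [f, adjMat, hadj]
  have hsum : ∑ b, ∑ u, χ b * (1 - χ u) * f b u = f v w := by
    simp [hcross]
  have htotal : ∑ b, ∑ u, χ b * (1 - χ u) * f b u
      = ∑ b, χ b * ∑ u, f b u - ∑ b, ∑ u, χ b * χ u * f b u := by
    simp only [mul_sum, ← sum_sub_distrib]
    exact sum_congr rfl fun b _ => sum_congr rfl fun u _ => by ring
  have hf : f v w = 0 := by
    rw [← hsum, htotal, hinner]
    simp [hrow]
  simp only [f, adjMat, hvw, if_true, one_mul] at hf
  linarith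

/-- A walk inside `S` starting in `S'` stays in `S'` if no step within `S` leaves `S'`. -/
theorem SimpleGraph.Reachable.induce_of_forall_adj {V : Type*} {G : SimpleGraph V} {S S' : Set V}
    (h : ∀ u v, G.Adj u v → u ∈ S → u ∈ S' → v ∈ S → v ∈ S') {a b : S}
    (hab : (G.induce S).Reachable a b) (ha : (a : V) ∈ S') :
    ∃ hb : (b : V) ∈ S', (G.induce S').Reachable ⟨a, ha⟩ ⟨b, hb⟩ := by
  obtain ⟨p⟩ := hab
  induction p with
  | nil => exact ⟨ha, .rfl⟩
  | @cons a c b hac _ ih =>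
    have hc : (c : V) ∈ S' := h a c hac a.2 ha c.2
    obtain ⟨hb, hcb⟩ := ih hc
    have hac' : (G.induce S').Adj ⟨a, ha⟩ ⟨c, hc⟩ := hac
    exact ⟨hb, hac'.reachable.trans hcb⟩

theorem IsCompOf.subset_of_forall_adj {V : Type*} {G : SimpleGraph V} {S S' C C' : Set V}
    (h : ∀ u v, G.Adj u v → u ∈ S → u ∈ S' → v ∈ S → v ∈ S')
    (hC : IsCompOf G S C) (hC' : IsCompOf G S' C') {a : V} (ha : a ∈ C) (ha' : a ∈ C') :
    C ⊆ C' := by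
  obtain ⟨c, rfl⟩ := hC
  obtain ⟨c', rfl⟩ := hC'
  obtain ⟨a, hac, rfl⟩ := ha
  obtain ⟨a', hac', haa'⟩ := ha'
  rintro _ ⟨b, hbc, rfl⟩
  rw [ConnectedComponent.mem_supp_iff] at hac hbc hac'
  have hab : (G.induce S).Reachable a b := ConnectedComponent.exact (hac.trans hbc.symm)
  obtain ⟨hb, hr⟩ := hab.induce_of_forall_adj h (haa' ▸ a'.2)
  refine ⟨⟨b, hb⟩, ?_, rfl⟩
  rw [ConnectedComponent.mem_supp_iff, ← hac', ← ConnectedComponent.sound hr]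
  congr 1
  exact Subtype.ext haa'.symm

theorem stmt_4 {V : Type*} [Fintype V] (G : SimpleGraph V) (hT : G.IsTree) (μ : ℝ)
    (x x' : V → ℝ) (hx : IsEigenvector G μ x) (hx' : IsEigenvector G μ x')
    (hind : LinearIndependent ℝ ![x, x'])
    (C C' : Set V) (hC : IsCompOf G {v | x v ≠ 0} C)
    (hC' : IsCompOf G {v | x' v ≠ 0} C') :
    C = C' ∨ Disjoint C C' := by
  have hprop (u v : V) (huv : G.Adj u v) : x u * x' v = x' u * x v :=
    (isAcyclic_iff_forall_isBridge.mp hT.isAcyclic huv).mul_eq_mul_of_mulVec_eq_smul huv hx.2 hx'.2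
  rw [or_iff_not_imp_right, Set.not_disjoint_iff]
  rintro ⟨a, ha, ha'⟩
  refine (hC.subset_of_forall_adj ?_ hC' ha ha').antisymm (hC'.subset_of_forall_adj ?_ hC ha' ha)
  · intro u v huv _ hu' hv hv'
    have := hprop u v huv
    simp_all
  · intro u v huv _ hu' hv hv'
    have h := hprop u v huv
    rw [hv', mul_zero] at h
    exact mul_ne_zero hu' hv h
end

section
/- Let T be a tree and x an eigenvector of T for eigenvalue λ. If v is a vertex with x(v) = 0 that is adjacent in T to some vertex w with x(w) ≠ 0, then every eigenvector of T for eigenvalue λ vanishes at v (i.e., v ∈ N_λ(T)). -/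
open SimpleGraph

open scoped Classical

/-- Green's identity for the adjacency matrix: for two eigenvectors, the flux of their Wronskian
through the boundary of a vertex set vanishes. -/
theorem sum_boundary_wronskian_eq_zero {V : Type*} [Fintype V] {G : SimpleGraph V} {μ : ℝ}
    {x z : V → ℝ} (hx : (adjMat G).mulVec x = μ • x) (hz : (adjMat G).mulVec z = μ • z)
    (S : Finset V) :
    ∑ u ∈ S, ∑ t ∈ Sᶜ, adjMat G u t * (x u * z t - z u * x t) = 0 := by
  have hsymm : ∀ u t, adjMat G u t = adjMat G t u := fun u t => by
    simp only [adjMat, G.adj_comm]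
  have hrow : ∀ u, ∑ t, adjMat G u t * (x u * z t - z u * x t) = 0 := by
    intro u
    have hxu : ∑ t, adjMat G u t * x t = μ * x u := congrFun hx u
    have hzu : ∑ t, adjMat G u t * z t = μ * z u := congrFun hz u
    calc ∑ t, adjMat G u t * (x u * z t - z u * x t)
        = x u * ∑ t, adjMat G u t * z t - z u * ∑ t, adjMat G u t * x t := by
          rw [Finset.mul_sum, Finset.mul_sum, ← Finset.sum_sub_distrib]
          exact Finset.sum_congr rfl fun t _ => by ring
      _ = 0 := by rw [hxu, hzu]; ring
  have hinner : ∑ u ∈ S, ∑ t ∈ S, adjMat G u t * (x u * z t - z u * x t) = 0 := by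
    have hneg : ∑ u ∈ S, ∑ t ∈ S, adjMat G u t * (x u * z t - z u * x t) =
        -∑ u ∈ S, ∑ t ∈ S, adjMat G u t * (x u * z t - z u * x t) := by
      conv_lhs => rw [Finset.sum_comm]
      simp only [← Finset.sum_neg_distrib]
      refine Finset.sum_congr rfl fun u _ => Finset.sum_congr rfl fun t _ => ?_
      rw [hsymm t u]
      ring
    linarith
  have htotal : ∑ u ∈ S, ∑ t, adjMat G u t * (x u * z t - z u * x t) = 0 :=
    Finset.sum_eq_zero fun u _ => hrow u
  simp only [← Finset.sum_add_sum_compl S, Finset.sum_add_distrib, hinner, zero_add] at htotal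
  exact htotal

/-- Every edge of an acyclic graph is the only edge leaving some vertex set. -/
theorem SimpleGraph.IsAcyclic.exists_unique_boundary_edge {V : Type*} {G : SimpleGraph V}
    (hG : G.IsAcyclic) {v w : V} (hadj : G.Adj v w) :
    ∃ S : Set V, w ∈ S ∧ v ∉ S ∧ ∀ u ∈ S, ∀ t ∉ S, G.Adj u t → u = w ∧ t = v := by
  have hv : ¬ (G.deleteEdges {s(v, w)}).Reachable v w :=
    isBridge_iff.mp (isAcyclic_iff_forall_adj_isBridge.mp hG hadj)
  refine ⟨{u | (G.deleteEdges {s(v, w)}).Reachable w u}, Reachable.refl w,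
    fun h => hv (Reachable.symm h), fun u hu t ht hut => ?_⟩
  by_cases he : s(u, t) = s(v, w)
  · rcases Sym2.eq_iff.mp he with ⟨rfl, rfl⟩ | h
    · exact absurd (Reachable.refl _) ht
    · exact h
  · exact absurd (Reachable.trans hu (Adj.reachable (deleteEdges_adj.mpr ⟨hut, he⟩))) ht

theorem stmt_5 {V : Type*} [Fintype V] (G : SimpleGraph V) (hT : G.IsTree) (μ : ℝ)
    (x : V → ℝ) (hx : IsEigenvector G μ x) (v w : V)
    (hv : x v = 0) (hadj : G.Adj v w) (hw : x w ≠ 0) :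
    v ∈ nSet G μ := by
  intro z hz
  obtain ⟨S, hwS, hvS, hS⟩ := hT.isAcyclic.exists_unique_boundary_edge hadj
  have h := sum_boundary_wronskian_eq_zero hx.2 hz.2 S.toFinset
  rw [Finset.sum_eq_single_of_mem w (by simpa using hwS),
    Finset.sum_eq_single_of_mem v (by simpa using hvS)] at h
  · simpa [adjMat, hadj.symm, hv, hw] using h
  · intro t ht htv
    have hwt : ¬ G.Adj w t := fun hwt => htv (hS w hwS t (by simpa using ht) hwt).2
    simp [adjMat, hwt]
  · intro u hu huw
    refine Finset.sum_eq_zero fun t ht => ?_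
    have hut : ¬ G.Adj u t :=
      fun hut => huw (hS u (by simpa using hu) t (by simpa using ht) hut).1
    simp [adjMat, hut]
end

section
/- Let T be a tree and λ an eigenvalue of T. Then the collection of vertex sets of the connected components of T[V(T) \ N_λ(T)] equals the union, taken over all eigenvectors x of T for eigenvalue λ, of the collections of vertex sets of the connected components of T[supp(x)]. In other words, a set C ⊆ V(T) is the vertex set of a component of T[V(T) \ N_λ(T)] if and only if there is an eigenvector x of T for λ such that C is the vertex set of a component of T[supp(x)]. -/
open SimpleGraph

open scoped Classical

/-- A component of `G[S]` stays a component after enlarging `S` by vertices not adjacent to it. -/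
theorem IsCompOf.mono {V : Type*} {G : SimpleGraph V} {S S' C : Set V} (hC : IsCompOf G S C)
    (hS : S ⊆ S') (h : ∀ u ∈ C, ∀ v ∈ S', G.Adj u v → v ∈ S) : IsCompOf G S' C := by
  obtain ⟨c, rfl⟩ := hC
  induction c using ConnectedComponent.ind with | _ u
  refine ⟨(G.induce S').connectedComponentMk ⟨u, hS u.2⟩, Set.Subset.antisymm ?_ ?_⟩
  · rintro _ ⟨w, hw, rfl⟩
    refine ⟨⟨w, hS w.2⟩, ?_, rfl⟩
    rw [ConnectedComponent.mem_supp_iff, ConnectedComponent.eq] at hw ⊢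
    exact hw.map (induceHomOfLE G hS).toHom
  · rintro _ ⟨w, hw, rfl⟩
    rw [ConnectedComponent.mem_supp_iff, ConnectedComponent.eq] at hw
    have hw' := (reachable_iff_reflTransGen _ _).1 hw.symm
    clear hw
    induction hw' with
    | refl => exact ⟨u, by simp, rfl⟩
    | @tail a b _ hab ih =>
      have hab' : G.Adj a.1 b.1 := hab
      have hb : b.1 ∈ S := h _ ih _ b.2 hab'
      obtain ⟨a', ha', haa⟩ := ih
      refine ⟨⟨b.1, hb⟩, ?_, rfl⟩
      rw [ConnectedComponent.mem_supp_iff, ConnectedComponent.eq] at ha' ⊢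
      have hadj : (G.induce S).Adj a' ⟨b.1, hb⟩ := by
        change G.Adj a'.1 b.1
        rwa [haa]
      exact hadj.reachable.symm.trans ha'

/-- In a forest, if an eigenvector is nonzero at `u` and zero at a neighbor `v` of `u`, then every
eigenvector for the same eigenvalue vanishes at `v`. -/
theorem mem_nSet_of_adj {V : Type*} [Fintype V] {G : SimpleGraph V} (hG : G.IsAcyclic) {μ : ℝ}
    {x : V → ℝ} (hx : IsEigenvector G μ x) {u v : V} (huv : G.Adj u v) (hu : x u ≠ 0)
    (hv : x v = 0) : v ∈ nSet G μ := by
  intro y hy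
  let B : Set V := {w | (G.deleteEdges {s(u, v)}).Reachable u w}
  have huB : u ∈ B := Reachable.refl u
  have hvB : v ∉ B := isBridge_iff.1 (isAcyclic_iff_forall_adj_isBridge.1 hG huv)
  have hB : ∀ w ∈ B, ∀ z, G.Adj w z → z ∉ B → w = u ∧ z = v := by
    intro w hw z hwz hz
    by_contra hne
    refine hz (Reachable.trans hw (Adj.reachable ?_))
    rw [deleteEdges_adj]
    refine ⟨hwz, fun hmem => ?_⟩
    rcases Sym2.eq_iff.1 (Set.mem_singleton_iff.1 hmem) with h | h
    · exact hne h
    · exact hvB (h.1 ▸ hw)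
  have hAx : (adjMat G).mulVec (B.indicator x) = μ • B.indicator x + Pi.single v (x u) := by
    ext w
    by_cases hw : w ∈ B
    · have hwv : w ≠ v := fun h => hvB (h ▸ hw)
      have hxw := congrFun hx.2 w
      simp only [Matrix.mulVec, dotProduct, Pi.smul_apply, Pi.add_apply] at hxw ⊢
      rw [Pi.single_eq_of_ne hwv, Set.indicator_of_mem hw, add_zero, ← hxw]
      refine Finset.sum_congr rfl fun z _ => ?_
      by_cases hz : z ∈ B
      · rw [Set.indicator_of_mem hz]
      · rw [Set.indicator_of_notMem hz]
        by_cases hwz : G.Adj w z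
        · rw [(hB w hw z hwz hz).2, hv]
        · simp [adjMat, hwz]
    · simp only [Matrix.mulVec, dotProduct, Pi.smul_apply, Pi.add_apply]
      rw [Set.indicator_of_notMem hw, smul_zero, zero_add, Finset.sum_eq_single u]
      · rw [Set.indicator_of_mem huB]
        by_cases hwv : w = v
        · subst hwv
          simp [adjMat, huv.symm]
        · have : ¬ G.Adj w u := fun h => hwv (hB u huB w h.symm hw).2
          simp [adjMat, this, hwv]
      · intro z _ hzu
        by_cases hz : z ∈ B
        · have : ¬ G.Adj w z := fun h => hzu (hB z hz w h.symm hw).1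
          simp [adjMat, this]
        · rw [Set.indicator_of_notMem hz, mul_zero]
      · simp
  have hsymm : (adjMat G).transpose = adjMat G := by
    ext a b
    simp [adjMat, G.adj_comm]
  have key : y ⬝ᵥ (adjMat G).mulVec (B.indicator x) =
      (adjMat G).mulVec y ⬝ᵥ B.indicator x := by
    rw [Matrix.dotProduct_mulVec, ← Matrix.mulVec_transpose, hsymm]
  rw [hAx, hy.2, dotProduct_add, dotProduct_smul, smul_dotProduct, dotProduct_single] at key
  simpa [hu] using key

/-- Some eigenvector is nonzero at every vertex outside `N_μ(G)`. -/
theorem exists_isEigenvector_support_eq {V : Type*} [Fintype V] {G : SimpleGraph V} {μ : ℝ}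
    (hμ : ∃ x, IsEigenvector G μ x) :
    ∃ x, IsEigenvector G μ x ∧ {v | x v ≠ 0} = (nSet G μ)ᶜ := by
  have hmem : ∀ x, x ∈ eigSpace G μ ↔ (adjMat G).mulVec x = μ • x := fun x => by
    simp [eigSpace, sub_eq_zero]
  obtain ⟨x, hx, hne⟩ := Module.Dual.exists_forall_mem_ne_zero_of_forall_exists (eigSpace G μ)
    (fun v : ((nSet G μ)ᶜ : Set V) => (LinearMap.proj v.1 : (V → ℝ) →ₗ[ℝ] ℝ)) (by
      rintro ⟨v, hv⟩
      simp only [nSet, Set.mem_compl_iff, Set.mem_ofPred_eq, not_forall] at hv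
      obtain ⟨x, hx, hxv⟩ := hv
      exact ⟨x, (hmem x).2 hx.2, hxv⟩)
  obtain ⟨x₀, hx₀⟩ := hμ
  obtain ⟨v, hv⟩ := Function.ne_iff.1 hx₀.1
  have hxe : IsEigenvector G μ x := by
    refine ⟨fun h => hne ⟨v, fun hvN => hv (hvN x₀ hx₀)⟩ ?_, (hmem x).1 hx⟩
    simp [h]
  exact ⟨x, hxe, Set.Subset.antisymm (fun w hw hwN => hw (hwN x hxe)) fun w hw => hne ⟨w, hw⟩⟩

theorem stmt_6 {V : Type*} [Fintype V] (G : SimpleGraph V) (hT : G.IsTree) (μ : ℝ)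
    (hμ : ∃ x, IsEigenvector G μ x) (C : Set V) :
    IsCompOf G ((nSet G μ)ᶜ) C ↔
      ∃ x, IsEigenvector G μ x ∧ IsCompOf G {v | x v ≠ 0} C := by
  constructor
  · intro hC
    obtain ⟨x, hx, hsupp⟩ := exists_isEigenvector_support_eq hμ
    exact ⟨x, hx, hsupp ▸ hC⟩
  · rintro ⟨x, hx, hC⟩
    refine hC.mono (fun v hv hvN => hv (hvN x hx)) fun u hu v hv huv hxv => ?_
    obtain ⟨c, rfl⟩ := hC
    obtain ⟨u, -, rfl⟩ := hu
    exact hv (mem_nSet_of_adj hT.isAcyclic hx huv u.2 hxv)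
end

section
/- Let T be a tree, let M be a maximum matching of T that misses the vertex a, and let M′ be a maximum matching of T that misses the vertex a′. Then a and a′ are not adjacent in T. Consequently, the set of all vertices each of which is missed by some maximum matching of T is an independent set in T. -/
open SimpleGraph

open scoped Classical

/-- A matching of `G`: a set of edges of `G`, pairwise non-incident. -/
def IsMatching {V : Type*} (G : SimpleGraph V) (M : Set (Sym2 V)) : Prop :=
  M ⊆ G.edgeSet ∧ M.Pairwise fun e f => ∀ v, ¬(v ∈ e ∧ v ∈ f)

/-- The matching `M` covers the vertex `v`. -/
def MCovers {V : Type*} (M : Set (Sym2 V)) (v : V) : Prop := ∃ e ∈ M, v ∈ e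

/-- `M` is a maximum matching of `G`. -/
def IsMaxMatching {V : Type*} (G : SimpleGraph V) (M : Set (Sym2 V)) : Prop :=
  IsMatching G M ∧ ∀ M', IsMatching G M' → M'.ncard ≤ M.ncard

/-- The edges of `M` inside `A` together with the edges of `M'` inside the complement of `A`. -/
def matchingGlue {V : Type*} (A : Set V) (M M' : Set (Sym2 V)) : Set (Sym2 V) :=
  {e ∈ M | ∀ v ∈ e, v ∈ A} ∪ {e ∈ M' | ∀ v ∈ e, v ∉ A}

theorem IsMatching.glue {V : Type*} {G : SimpleGraph V} {M M' : Set (Sym2 V)}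
    (hM : IsMatching G M) (hM' : IsMatching G M') (A : Set V) :
    IsMatching G (matchingGlue A M M') := by
  refine ⟨?_, ?_⟩
  · rintro e (he | he)
    exacts [hM.1 he.1, hM'.1 he.1]
  · rintro e (he | he) f (hf | hf) hne v ⟨hve, hvf⟩
    · exact hM.2 he.1 hf.1 hne v ⟨hve, hvf⟩
    · exact hf.2 v hvf (he.2 v hve)
    · exact he.2 v hve (hf.2 v hvf)
    · exact hM'.2 he.1 hf.1 hne v ⟨hve, hvf⟩

theorem ncard_matchingGlue {V : Type*} [Fintype V] (A : Set V) (M M' : Set (Sym2 V)) :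
    (matchingGlue A M M').ncard =
      {e ∈ M | ∀ v ∈ e, v ∈ A}.ncard + {e ∈ M' | ∀ v ∈ e, v ∉ A}.ncard := by
  refine Set.ncard_union_eq (Set.disjoint_left.2 ?_) (Set.toFinite _) (Set.toFinite _)
  intro e he hf
  induction e with
  | _ x y => exact hf.2 x (Sym2.mem_mk_left x y) (he.2 x (Sym2.mem_mk_left x y))

theorem matchingGlue_self {V : Type*} {A : Set V} {M : Set (Sym2 V)}
    (h : ∀ x y, s(x, y) ∈ M → (x ∈ A ↔ y ∈ A)) : matchingGlue A M M = M := by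
  ext e
  induction e with
  | _ x y =>
    have := h x y
    simp only [matchingGlue, Set.mem_union, Set.mem_ofPred_eq, Sym2.mem_iff, forall_eq_or_imp,
      forall_eq]
    tauto

theorem IsMatching.insert_edge {V : Type*} {G : SimpleGraph V} {M : Set (Sym2 V)}
    (hM : IsMatching G M) {a b : V} (hab : G.Adj a b) (ha : ¬MCovers M a) (hb : ¬MCovers M b) :
    IsMatching G (insert s(a, b) M) := by
  have key : ∀ e ∈ M, ∀ v, v ∈ e → v ∉ s(a, b) := by
    intro e he v hv hvab
    rcases Sym2.mem_iff.1 hvab with rfl | rfl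
    exacts [ha ⟨e, he, hv⟩, hb ⟨e, he, hv⟩]
  refine ⟨Set.insert_subset hab hM.1, ?_⟩
  rintro e (rfl | he) f (rfl | hf) hne v ⟨hve, hvf⟩
  · exact hne rfl
  · exact key f hf v hvf hve
  · exact key e he v hve hvf
  · exact hM.2 he hf hne v ⟨hve, hvf⟩

theorem IsMaxMatching.mCovers_of_adj {V : Type*} [Fintype V] {G : SimpleGraph V}
    {M : Set (Sym2 V)} (hM : IsMaxMatching G M) {a b : V} (hab : G.Adj a b)
    (ha : ¬MCovers M a) : MCovers M b := by
  by_contra hb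
  have hnot : s(a, b) ∉ M := fun h => ha ⟨_, h, Sym2.mem_mk_left a b⟩
  have := hM.2 _ (hM.1.insert_edge hab ha hb)
  rw [Set.ncard_insert_of_notMem hnot (Set.toFinite _)] at this
  omega

/-- Adjacent vertices of a forest cannot both be missed by maximum matchings. The two sides of
the bridge joining them allow the matchings to be recombined into a maximum matching missing
both. -/
theorem not_adj_of_isMaxMatching {V : Type*} [Fintype V] {G : SimpleGraph V}
    (hG : G.IsAcyclic) {M M' : Set (Sym2 V)} {a b : V} (hM : IsMaxMatching G M)
    (hM' : IsMaxMatching G M') (ha : ¬MCovers M a) (hb : ¬MCovers M' b) : ¬G.Adj a b := by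
  intro hab
  let H := G.deleteEdges {s(a, b)}
  let A : Set V := {v | H.Reachable a v}
  have haA : a ∈ A := Reachable.refl a
  have hbA : b ∉ A := isBridge_iff.1 (isAcyclic_iff_forall_isBridge.1 hG hab)
  have cross : ∀ N : Set (Sym2 V), IsMatching G N → s(a, b) ∉ N →
      ∀ x y, s(x, y) ∈ N → (x ∈ A ↔ y ∈ A) := by
    intro N hN hnot x y hxy
    have hadj : H.Adj x y :=
      deleteEdges_adj.2 ⟨hN.1 hxy, fun h => hnot (Set.mem_singleton_iff.1 h ▸ hxy)⟩
    exact ⟨fun h => h.trans hadj.reachable, fun h => h.trans hadj.symm.reachable⟩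
  have hglueM := matchingGlue_self
    (cross M hM.1 fun h => ha ⟨_, h, Sym2.mem_mk_left a b⟩)
  have hglueM' := matchingGlue_self
    (cross M' hM'.1 fun h => hb ⟨_, h, Sym2.mem_mk_right a b⟩)
  have hcard := ncard_matchingGlue A M M
  have hcard' := ncard_matchingGlue A M' M'
  rw [hglueM] at hcard
  rw [hglueM'] at hcard'
  have hN := hM.1.glue hM'.1 A
  have hmax : IsMaxMatching G (matchingGlue A M M') := by
    refine ⟨hN, fun N hN' => (hM.2 N hN').trans ?_⟩
    have h₁ := hM'.2 _ (hM'.1.glue hM.1 A)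
    rw [ncard_matchingGlue] at h₁ ⊢
    have h₂ := hM.2 _ hM'.1
    have h₃ := hM'.2 _ hM.1
    omega
  have hNa : ¬MCovers (matchingGlue A M M') a := by
    rintro ⟨e, he | he, hae⟩
    exacts [ha ⟨e, he.1, hae⟩, he.2 a hae haA]
  obtain ⟨e, he | he, hbe⟩ := hmax.mCovers_of_adj hab hNa
  exacts [hbA (he.2 b hbe), hb ⟨e, he.1, hbe⟩]

theorem stmt_11 {V : Type*} [Fintype V] (G : SimpleGraph V) (hT : G.IsTree)
    (M M' : Set (Sym2 V)) (a a' : V)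
    (hM : IsMaxMatching G M) (hM' : IsMaxMatching G M')
    (ha : ¬MCovers M a) (ha' : ¬MCovers M' a') :
    ¬G.Adj a a' ∧
      ({v | ∃ N, IsMaxMatching G N ∧ ¬MCovers N v} : Set V).Pairwise
        fun u w => ¬G.Adj u w := by
  refine ⟨not_adj_of_isMaxMatching hT.isAcyclic hM hM' ha ha', ?_⟩
  rintro u ⟨N, hN, hu⟩ w ⟨N', hN', hw⟩ -
  exact not_adj_of_isMaxMatching hT.isAcyclic hN hN' hu hw
end

section
/- Let T be a tree and v a vertex of T. Then v is covered by every maximum matching of T if and only if every vector in the null space of the adjacency matrix of T vanishes at v. Equivalently, some maximum matching of T misses v if and only if there exists a vector x with A x = 0 and x(v) ≠ 0, where A is the adjacency matrix of T. -/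
open SimpleGraph

open scoped Classical

theorem adjMat_mulVec_eq_zero_iff {V : Type*} [Fintype V] {G : SimpleGraph V} {x : V → ℝ} :
    (adjMat G).mulVec x = 0 ↔ ∀ a, ∑ b, (if G.Adj a b then x b else 0) = 0 := by
  simp [funext_iff, adjMat, Matrix.mulVec, dotProduct]

theorem deleteIncidenceSet_adj_iff {V : Type*} {G : SimpleGraph V} {w a b : V} :
    (G.deleteIncidenceSet w).Adj a b ↔ G.Adj a b ∧ a ≠ w ∧ b ≠ w :=
  G.deleteIncidenceSet_adj

theorem mem_edgeSet_deleteIncidenceSet_iff {V : Type*} {G : SimpleGraph V} {w : V} {e : Sym2 V} :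
    e ∈ (G.deleteIncidenceSet w).edgeSet ↔ e ∈ G.edgeSet ∧ w ∉ e := by
  induction e with
  | _ a b =>
    simp only [mem_edgeSet, deleteIncidenceSet_adj_iff, Sym2.mem_iff]
    tauto

/-- An acyclic finite graph with an edge has a vertex of degree one other than `v`. -/
theorem exists_leaf_ne {V : Type*} [Fintype V] {G : SimpleGraph V} (hG : G.IsAcyclic)
    (hne : G ≠ ⊥) (v : V) : ∃ u w, u ≠ v ∧ ∀ z, G.Adj u z ↔ z = w := by
  have : Nonempty V := ⟨v⟩
  obtain ⟨a, b, p, hp, hmax⟩ := Walk.exists_isPath_forall_isPath_length_le_length G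
  have hnil : ¬ p.Nil := by
    intro hn
    obtain ⟨c, d, hcd⟩ := ne_bot_iff_exists_adj.mp hne
    have := hmax c d hcd.toWalk (by simp [hcd.ne])
    rw [← Walk.length_eq_zero_iff] at hn
    simp [hn] at this
  have ha : ∀ z, G.Adj a z ↔ z = p.snd := by
    refine fun z => ⟨fun hadj => ?_, fun h => h ▸ p.adj_snd hnil⟩
    apply hG.eq_snd_of_adj_start hp hadj
    have : ¬(p.cons hadj.symm).IsPath := by grind [Walk.length_cons]
    grind [hp.cons]
  have hb : ∀ z, G.Adj b z ↔ z = p.penultimate := by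
    refine fun z => ⟨fun hadj => ?_, fun h => h ▸ (p.adj_penultimate hnil).symm⟩
    apply hG.eq_penultimate_of_adj_end hp hadj
    have : ¬(p.concat hadj).IsPath := by grind [Walk.length_concat]
    grind [hp.concat]
  have hab : a ≠ b := hp.nil_iff_eq.not.mp hnil
  by_cases hav : a = v
  · exact ⟨b, _, fun h => hab (hav.trans h.symm), hb⟩
  · exact ⟨a, _, hav, ha⟩

/-- Null vectors vanish at the neighbor of a leaf. -/
theorem null_apply_eq_zero_of_leaf {V : Type*} [Fintype V] {G : SimpleGraph V} {u w : V}
    (hu : ∀ z, G.Adj u z ↔ z = w) {x : V → ℝ} (hx : (adjMat G).mulVec x = 0) : x w = 0 := by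
  have := adjMat_mulVec_eq_zero_iff.mp hx u
  simpa [hu] using this

theorem exists_null_iff_of_leaf {V : Type*} [Fintype V] {G : SimpleGraph V} {u w v : V}
    (hu : ∀ z, G.Adj u z ↔ z = w) (hvu : v ≠ u) (hvw : v ≠ w) :
    (∃ x : V → ℝ, (adjMat G).mulVec x = 0 ∧ x v ≠ 0) ↔
      ∃ x : V → ℝ, (adjMat (G.deleteIncidenceSet w)).mulVec x = 0 ∧ x v ≠ 0 := by
  have hwu : G.Adj w u := ((hu w).mpr rfl).symm
  have hne : w ≠ u := hwu.ne
  constructor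
  · rintro ⟨x, hx, hxv⟩
    have hw := null_apply_eq_zero_of_leaf hu hx
    refine ⟨x, adjMat_mulVec_eq_zero_iff.mpr fun a => ?_, hxv⟩
    by_cases ha : a = w
    · simp [deleteIncidenceSet_adj_iff, ha]
    · refine Eq.trans ?_ (adjMat_mulVec_eq_zero_iff.mp hx a)
      refine Finset.sum_congr rfl fun b _ => ?_
      by_cases hb : b = w
      · simp [hb, hw]
      · simp [deleteIncidenceSet_adj_iff, ha, hb]
  · rintro ⟨x, hx, hxv⟩
    set s := ∑ b ∈ Finset.univ.erase u, (if G.Adj w b then x b else 0) with hs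
    refine ⟨fun b => if b = u then -s else if b = w then 0 else x b,
      adjMat_mulVec_eq_zero_iff.mpr fun a => ?_, by simpa [hvu, hvw] using hxv⟩
    by_cases ha : a = w
    · subst ha
      rw [← Finset.add_sum_erase _ _ (Finset.mem_univ u)]
      simp only [hwu, if_true]
      rw [neg_add_eq_zero, hs]
      refine Finset.sum_congr rfl fun b hb => ?_
      have hbu := Finset.ne_of_mem_erase hb
      by_cases hb' : b = a
      · simp [hb']
      · simp [hbu, hb']
    · refine Eq.trans ?_ (adjMat_mulVec_eq_zero_iff.mp hx a)
      refine Finset.sum_congr rfl fun b _ => ?_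
      by_cases hb : b = w
      · simp [deleteIncidenceSet_adj_iff, hb, hne]
      · by_cases hbu : b = u
        · have : ¬ G.Adj a b := fun h => ha ((hu a).mp (hbu ▸ h.symm))
          simp [deleteIncidenceSet_adj_iff, this]
        · simp [deleteIncidenceSet_adj_iff, ha, hb, hbu]

theorem IsMatching.mono {V : Type*} {G H : SimpleGraph V} (hGH : G ≤ H) {M : Set (Sym2 V)}
    (hM : IsMatching G M) : IsMatching H M :=
  ⟨hM.1.trans (edgeSet_mono hGH), hM.2⟩

theorem IsMatching.insert {V : Type*} {G : SimpleGraph V} {M : Set (Sym2 V)} {a b : V}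
    (hM : IsMatching G M) (hab : G.Adj a b) (ha : ¬ MCovers M a) (hb : ¬ MCovers M b) :
    IsMatching G (insert s(a, b) M) := by
  refine ⟨Set.insert_subset hab hM.1, hM.2.insert fun e he _ => ?_⟩
  have key : ∀ v, ¬ (v ∈ s(a, b) ∧ v ∈ e) := by
    rintro v ⟨hv, hve⟩
    rcases Sym2.mem_iff.mp hv with rfl | rfl
    · exact ha ⟨e, he, hve⟩
    · exact hb ⟨e, he, hve⟩
  exact ⟨key, fun v h => key v h.symm⟩

theorem ncard_insert_of_not_mCovers {V : Type*} [Fintype V] {M : Set (Sym2 V)} {a b : V}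
    (ha : ¬ MCovers M a) : (insert s(a, b) M).ncard = M.ncard + 1 :=
  Set.ncard_insert_of_notMem fun h => ha ⟨_, h, Sym2.mem_mk_left a b⟩

theorem IsMatching.not_mCovers_of_isolated {V : Type*} {G : SimpleGraph V} {M : Set (Sym2 V)}
    {a : V} (hM : IsMatching G M) (ha : ∀ b, ¬ G.Adj a b) : ¬ MCovers M a := by
  rintro ⟨e, he, hae⟩
  obtain ⟨b, rfl⟩ := Sym2.mem_iff_exists.mp hae
  exact ha b (hM.1 he)

/-- Deleting the edges at `w` from a matching removes at most one edge. -/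
theorem IsMatching.deleteIncidenceSet {V : Type*} [Fintype V] {G : SimpleGraph V}
    {M : Set (Sym2 V)} (hM : IsMatching G M) (w : V) :
    IsMatching (G.deleteIncidenceSet w) {e ∈ M | w ∉ e} ∧
      M.ncard ≤ {e ∈ M | w ∉ e}.ncard + 1 := by
  refine ⟨⟨fun e he => mem_edgeSet_deleteIncidenceSet_iff.mpr ⟨hM.1 he.1, he.2⟩,
    hM.2.mono fun e he => he.1⟩, ?_⟩
  have h1 : {e ∈ M | w ∈ e}.ncard ≤ 1 := by
    rw [Set.ncard_le_one]
    intro e he f hf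
    by_contra hef
    exact hM.2 he.1 hf.1 hef w ⟨he.2, hf.2⟩
  have h2 : M = {e ∈ M | w ∉ e} ∪ {e ∈ M | w ∈ e} := by
    ext e
    simp only [Set.mem_union, Set.mem_ofPred_eq]
    tauto
  calc M.ncard = ({e ∈ M | w ∉ e} ∪ {e ∈ M | w ∈ e}).ncard := by rw [← h2]
    _ ≤ _ := Set.ncard_union_le _ _
    _ ≤ _ := by omega

/-- A matching that avoids the neighbor `w` of a leaf `u` extends by the edge `uw`. -/
theorem IsMatching.insert_leaf {V : Type*} {G : SimpleGraph V} {u w : V}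
    (hu : ∀ z, G.Adj u z ↔ z = w) {M : Set (Sym2 V)}
    (hM : IsMatching (G.deleteIncidenceSet w) M) :
    IsMatching G (Insert.insert s(u, w) M) ∧ ¬ MCovers M u := by
  have hMu : ¬ MCovers M u := hM.not_mCovers_of_isolated fun b hb =>
    (deleteIncidenceSet_adj_iff.mp hb).2.2 ((hu b).mp (deleteIncidenceSet_adj_iff.mp hb).1)
  have hMw : ¬ MCovers M w := hM.not_mCovers_of_isolated fun b hb =>
    (deleteIncidenceSet_adj_iff.mp hb).2.1 rfl
  exact ⟨(hM.mono (G.deleteIncidenceSet_le w)).insert ((hu w).mpr rfl) hMu hMw, hMu⟩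

theorem exists_isMaxMatching_iff_of_leaf {V : Type*} [Fintype V] {G : SimpleGraph V} {u w v : V}
    (hu : ∀ z, G.Adj u z ↔ z = w) (hvu : v ≠ u) (hvw : v ≠ w) :
    (∃ M, IsMaxMatching G M ∧ ¬ MCovers M v) ↔
      ∃ M, IsMaxMatching (G.deleteIncidenceSet w) M ∧ ¬ MCovers M v := by
  constructor
  · rintro ⟨M, ⟨hM, hmax⟩, hv⟩
    obtain ⟨hM', hcard⟩ := hM.deleteIncidenceSet w
    refine ⟨_, ⟨hM', fun N hN => ?_⟩, fun ⟨e, he, hve⟩ => hv ⟨e, he.1, hve⟩⟩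
    obtain ⟨hN', hNu⟩ := hN.insert_leaf hu
    have := hmax _ hN'
    rw [ncard_insert_of_not_mCovers hNu] at this
    omega
  · rintro ⟨M, ⟨hM, hmax⟩, hv⟩
    obtain ⟨hM', hMu⟩ := hM.insert_leaf hu
    refine ⟨_, ⟨hM', fun N hN => ?_⟩, ?_⟩
    · rw [ncard_insert_of_not_mCovers hMu]
      obtain ⟨hN', hcard⟩ := hN.deleteIncidenceSet w
      have := hmax _ hN'
      omega
    · rintro ⟨e, he, hve⟩
      rcases he with rfl | he
      · rcases Sym2.mem_iff.mp hve with h | h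
        exacts [hvu h, hvw h]
      · exact hv ⟨e, he, hve⟩

/-- The neighbor of a leaf is covered by every maximum matching. -/
theorem IsMaxMatching.mCovers_of_leaf {V : Type*} [Fintype V] {G : SimpleGraph V} {u w : V}
    (hu : ∀ z, G.Adj u z ↔ z = w) {M : Set (Sym2 V)} (hM : IsMaxMatching G M) :
    MCovers M w := by
  by_contra hw
  have hMu : ¬ MCovers M u := by
    rintro ⟨e, he, hue⟩
    obtain ⟨b, rfl⟩ := Sym2.mem_iff_exists.mp hue
    obtain rfl := (hu b).mp (hM.1.1 he)
    exact hw ⟨_, he, Sym2.mem_mk_right u b⟩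
  have := hM.2 _ (hM.1.insert ((hu w).mpr rfl) hMu hw)
  rw [ncard_insert_of_not_mCovers hMu] at this
  omega

theorem SimpleGraph.IsAcyclic.exists_isMaxMatching_iff_exists_null {V : Type*} [Fintype V]
    {G : SimpleGraph V} (hG : G.IsAcyclic) (v : V) :
    (∃ M, IsMaxMatching G M ∧ ¬ MCovers M v) ↔
      ∃ x : V → ℝ, (adjMat G).mulVec x = 0 ∧ x v ≠ 0 := by
  induction hn : G.edgeSet.ncard using Nat.strong_induction_on generalizing G with
  | _ n ih =>
    by_cases hbot : G = ⊥
    · subst hbot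
      refine iff_of_true ⟨∅, ⟨⟨by simp, by simp⟩, fun M hM => ?_⟩, by simp [MCovers]⟩
        ⟨fun _ => 1, adjMat_mulVec_eq_zero_iff.mpr (by simp), one_ne_zero⟩
      have : M = ∅ := by simpa using hM.1
      simp [this]
    · obtain ⟨u, w, huv, hu⟩ := exists_leaf_ne hG hbot v
      by_cases hvw : v = w
      · subst hvw
        exact iff_of_false (fun ⟨M, hM, hMv⟩ => hMv (hM.mCovers_of_leaf hu))
          fun ⟨x, hx, hxv⟩ => hxv (null_apply_eq_zero_of_leaf hu hx)
      · rw [exists_isMaxMatching_iff_of_leaf hu huv.symm hvw,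
          exists_null_iff_of_leaf hu huv.symm hvw]
        refine ih _ ?_ (hG.anti (G.deleteIncidenceSet_le w)) rfl
        rw [← hn]
        refine Set.ncard_lt_ncard ⟨edgeSet_mono (G.deleteIncidenceSet_le w), fun h => ?_⟩
        have huw : s(u, w) ∈ G.edgeSet := (hu w).mpr rfl
        exact (mem_edgeSet_deleteIncidenceSet_iff.mp (h huw)).2 (Sym2.mem_mk_right u w)

theorem stmt_12 {V : Type*} [Fintype V] (G : SimpleGraph V) (hT : G.IsTree) (v : V) :
    ((∀ M, IsMaxMatching G M → MCovers M v) ↔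
        ∀ x : V → ℝ, (adjMat G).mulVec x = 0 → x v = 0) ∧
      ((∃ M, IsMaxMatching G M ∧ ¬MCovers M v) ↔
        ∃ x : V → ℝ, (adjMat G).mulVec x = 0 ∧ x v ≠ 0) := by
  have h := hT.isAcyclic.exists_isMaxMatching_iff_exists_null v
  refine ⟨?_, h⟩
  rw [← not_iff_not]
  push Not
  exact h
end

section
/- Let T be a tree and suppose x is an eigenvector of T for eigenvalue λ such that every entry of x belongs to {0, 1, −1}. Then λ ∈ {0, 1, −1}. -/
open SimpleGraph

open scoped Classical

/-- In an acyclic graph in which no vertex has all its neighbors equal to one vertex, there are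
paths of every length. -/
theorem SimpleGraph.IsAcyclic.exists_isPath_length_eq {W : Type*} [Nonempty W] {H : SimpleGraph W}
    (hH : H.IsAcyclic) (h : ∀ v u, ∃ w, H.Adj v w ∧ w ≠ u) (n : ℕ) :
    ∃ (u v : W) (p : H.Walk u v), p.IsPath ∧ p.length = n := by
  induction n with
  | zero =>
    obtain ⟨u⟩ := ‹Nonempty W›
    exact ⟨u, u, .nil, .nil, rfl⟩
  | succ n ih =>
    obtain ⟨u, v, p, hp, hlen⟩ := ih
    obtain ⟨w, huw, hw⟩ := h u p.snd
    have hnot : w ∉ p.support := fun hmem => hw (hH.eq_snd_of_adj_start hp huw hmem)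
    exact ⟨w, v, .cons huw.symm p, hp.cons hnot, by simp [hlen]⟩

/-- A nonempty finite acyclic graph has a vertex all of whose neighbors are equal. -/
theorem SimpleGraph.IsAcyclic.exists_forall_adj_eq {W : Type*} [Fintype W] [Nonempty W]
    {H : SimpleGraph W} (hH : H.IsAcyclic) : ∃ v u, ∀ w, H.Adj v w → w = u := by
  by_contra! h
  obtain ⟨u, v, p, hp, hlen⟩ := hH.exists_isPath_length_eq h (Fintype.card W)
  exact absurd hp.length_lt (by omega)

theorem stmt_16 {V : Type*} [Fintype V] (G : SimpleGraph V) (hT : G.IsTree) (μ : ℝ)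
    (x : V → ℝ) (hx : IsEigenvector G μ x)
    (hval : ∀ v, x v = 0 ∨ x v = 1 ∨ x v = -1) :
    μ = 0 ∨ μ = 1 ∨ μ = -1 := by
  obtain ⟨hx0, heig⟩ := hx
  have hsum : ∀ v, ∑ w, (if G.Adj v w then x w else 0) = μ * x v := by
    intro v
    simpa [Matrix.mulVec, dotProduct, adjMat] using congrFun heig v
  obtain ⟨v₀, hv₀⟩ := Function.ne_iff.mp hx0
  have : Nonempty {v | x v ≠ 0} := ⟨⟨v₀, hv₀⟩⟩
  obtain ⟨⟨v, hv⟩, ⟨u, _⟩, hu⟩ := (hT.isAcyclic.induce {v | x v ≠ 0}).exists_forall_adj_eq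
  have hother : ∀ w, w ≠ u → (if G.Adj v w then x w else 0) = 0 := by
    intro w hwu
    by_contra hne
    obtain ⟨hadj, hxw⟩ := ite_ne_right_iff.mp hne
    exact hwu (congrArg Subtype.val (hu ⟨w, hxw⟩ hadj))
  have hv' := hsum v
  rw [Fintype.sum_eq_single u hother] at hv'
  have hvne : x v ≠ 0 := hv
  rcases hval v with h | h | h
  · exact absurd h hvne
  all_goals
    rw [h] at hv'
    rcases hval u with h' | h' | h' <;> rw [h'] at hv' <;> split_ifs at hv' <;> grind
end

section
/- Let G be a tree on the vertex set {1, …, n} and let M be a real symmetric n×n matrix with pattern G, i.e., for all indices i, j: M_{ij} ≠ 0 if and only if i and j are adjacent in G (in particular all diagonal entries of M are zero). Let supp(M, 0) be the set of indices i such that some vector x with M x = 0 has x_i ≠ 0. Then the dimension of the null space of M equals the number of connected components of the induced subgraph G[supp(M, 0)] minus the number of indices not in supp(M, 0) that are adjacent in G to some index of supp(M, 0). -/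
open SimpleGraph

open scoped Classical

namespace SimpleGraph

variable {V : Type*} [Fintype V] {G : SimpleGraph V}

/-- A symmetric edge weighting of a finite forest whose weights sum to zero at every vertex
vanishes: the unsigned incidence matrix of a forest has linearly independent columns. -/
theorem IsAcyclic.weight_eq_zero (hG : G.IsAcyclic) {f : V → V → ℝ}
    (hsymm : ∀ i j, f i j = f j i) (hadj : ∀ i j, f i j ≠ 0 → G.Adj i j)
    (hsum : ∀ i, ∑ j, f i j = 0) (i j : V) : f i j = 0 := by
  by_contra hij
  let H : SimpleGraph V :=
    { Adj := fun a b => f a b ≠ 0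
      symm := ⟨fun a b h => by rwa [hsymm]⟩
      loopless := ⟨fun a h => (hadj a a h).ne rfl⟩ }
  have hH : H.IsAcyclic := hG.anti fun a b h => hadj a b h
  have : Nonempty V := ⟨i⟩
  obtain ⟨u, v, p, hp, hmax⟩ := Walk.exists_isPath_forall_isPath_length_le_length H
  have hlen : 1 ≤ p.length := by
    have hadj' : H.Adj i j := hij
    simpa using hmax i j (Path.singleton hadj').1 (Path.singleton hadj').2
  have hnil : ¬ p.Nil := by
    rw [← Walk.length_eq_zero_iff]
    omega
  obtain ⟨w, hw, hne⟩ : ∃ w, w ≠ p.snd ∧ f u w ≠ 0 := by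
    by_contra! h
    have hu := hsum u
    rw [Fintype.sum_eq_single p.snd h] at hu
    exact p.adj_snd hnil hu
  have huw : H.Adj u w := hne
  refine hw (hH.eq_snd_of_adj_start hp huw ?_)
  by_contra hsupp
  have hle := hmax _ _ (Walk.cons huw.symm p) (hp.cons hsupp)
  simp at hle

end SimpleGraph

namespace Matrix

variable {V : Type*} [Fintype V] {G : SimpleGraph V} {M : Matrix V V ℝ}

/-- A null vector of a symmetric matrix whose pattern is a forest does not charge both ends of
an edge. -/
theorem mul_eq_zero_of_mulVec_eq_zero (hG : G.IsAcyclic) (hsym : M.IsSymm)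
    (hpat : ∀ i j, M i j ≠ 0 ↔ G.Adj i j) {x : V → ℝ} (hx : M.mulVec x = 0) {i j : V}
    (hij : G.Adj i j) : x i * x j = 0 := by
  have h := hG.weight_eq_zero (f := fun a b => x a * (M a b * x b))
    (fun a b => by rw [hsym.apply b a]; ring)
    (fun a b hab => (hpat a b).1 (left_ne_zero_of_mul (right_ne_zero_of_mul hab)))
    (fun a => by
      rw [← Finset.mul_sum]
      have := congrFun hx a
      simp only [mulVec, dotProduct, Pi.zero_apply] at this
      rw [this, mul_zero]) i j
  have hM := (hpat i j).2 hij
  have : M i j * (x i * x j) = 0 := by linear_combination h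
  exact (mul_eq_zero.1 this).resolve_left hM

/-- The null support of a symmetric matrix whose pattern is a forest is independent. -/
theorem not_adj_of_null_support (hG : G.IsAcyclic) (hsym : M.IsSymm)
    (hpat : ∀ i j, M i j ≠ 0 ↔ G.Adj i j) {x y : V → ℝ} (hx : M.mulVec x = 0)
    (hy : M.mulVec y = 0) {i j : V} (hxi : x i ≠ 0) (hyj : y j ≠ 0) : ¬ G.Adj i j := by
  intro hij
  have h1 := (mul_eq_zero.1 (mul_eq_zero_of_mulVec_eq_zero hG hsym hpat hx hij)).resolve_left hxi
  have h2 := (mul_eq_zero.1 (mul_eq_zero_of_mulVec_eq_zero hG hsym hpat hy hij)).resolve_right hyj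
  have h3 := mul_eq_zero_of_mulVec_eq_zero hG hsym hpat (x := x + y)
    (by rw [mulVec_add, hx, hy, add_zero]) hij
  simp only [Pi.add_apply, h1, h2, add_zero, zero_add] at h3
  exact mul_ne_zero hxi hyj h3

/-- If `y` is supported away from the support of a null vector `x` of `M`, and `M y` vanishes on
the support of `x`, then no edge joins the supports of `x` and `y`. -/
theorem mul_eq_zero_of_disjoint_support (hG : G.IsAcyclic) (hsym : M.IsSymm)
    (hpat : ∀ i j, M i j ≠ 0 ↔ G.Adj i j) {x y : V → ℝ} (hx : M.mulVec x = 0)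
    (hy : ∀ j, x j ≠ 0 → M.mulVec y j = 0) (hxy : ∀ i, x i ≠ 0 → y i = 0) {i j : V}
    (hij : G.Adj i j) : y i * x j = 0 := by
  by_cases hxj : x j = 0
  · rw [hxj, mul_zero]
  have h := hG.weight_eq_zero (f := fun a b => y a * (M a b * x b) + x a * (M a b * y b))
    (fun a b => by rw [hsym.apply b a]; ring)
    (fun a b hab => (hpat a b).1 fun h0 => hab (by simp [h0]))
    (fun a => by
      rw [Finset.sum_add_distrib, ← Finset.mul_sum, ← Finset.mul_sum]
      have h1 := congrFun hx a
      simp only [mulVec, dotProduct, Pi.zero_apply] at h1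
      rw [h1, mul_zero, zero_add]
      by_cases ha : x a = 0
      · rw [ha, zero_mul]
      · have h2 := hy a ha
        simp only [mulVec, dotProduct] at h2
        rw [h2, mul_zero]) i j
  have hM := (hpat i j).2 hij
  rw [hxy j hxj] at h
  have : M i j * (y i * x j) = 0 := by linear_combination h
  exact (mul_eq_zero.1 this).resolve_left hM

theorem mulVec_extend_zero (A : Matrix V V ℝ) (S : Set V) (x : S → ℝ) (i : V) :
    A.mulVec (Function.extend Subtype.val x 0) i = ∑ j : S, A i j * x j := by
  symm
  refine Fintype.sum_of_injective Subtype.val Subtype.val_injective _ _ (fun j hj => ?_)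
    (fun j => ?_)
  · rw [Function.extend_apply' _ _ _ (by simpa using hj)]
    simp
  · rw [Subtype.val_injective.extend_apply]

theorem extend_restrict_of_support_subset {ι : Type*} {S : Set ι} {x : ι → ℝ}
    (hx : ∀ i, x i ≠ 0 → i ∈ S) :
    Function.extend Subtype.val (fun i : S => x i) 0 = x := by
  ext i
  by_cases hi : i ∈ S
  · exact Subtype.val_injective.extend_apply (fun i : S => x i) 0 ⟨i, hi⟩
  · rw [Function.extend_apply' _ _ _ (by simpa using hi)]
    by_contra h
    exact hi (hx i fun h0 => h (by simp [h0]))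

end Matrix

theorem SimpleGraph.card_connectedComponent_bot (V : Type*) :
    Nat.card (⊥ : SimpleGraph V).ConnectedComponent = Nat.card V := by
  refine (Nat.card_congr (Equiv.ofBijective (⊥ : SimpleGraph V).connectedComponentMk
    ⟨fun u v h => ?_, Quot.mk_surjective⟩)).symm
  exact SimpleGraph.reachable_bot.1 (SimpleGraph.ConnectedComponent.eq.1 h)

theorem stmt_18 (n : ℕ) (G : SimpleGraph (Fin n)) (hT : G.IsTree)
    (M : Matrix (Fin n) (Fin n) ℝ) (hsym : M.IsSymm)
    (hpat : ∀ i j, M i j ≠ 0 ↔ G.Adj i j)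
    (S : Set (Fin n)) (hS : S = {i | ∃ x : Fin n → ℝ, M.mulVec x = 0 ∧ x i ≠ 0}) :
    (Module.finrank ℝ (LinearMap.ker M.mulVecLin) : ℤ) =
      Nat.card (G.induce S).ConnectedComponent -
        ({i | i ∉ S ∧ ∃ j ∈ S, G.Adj i j} : Set (Fin n)).ncard := by
  have hG := hT.isAcyclic
  have hsupp : ∀ {x : Fin n → ℝ}, M.mulVec x = 0 → ∀ i, x i ≠ 0 → i ∈ S := by
    intro x hx i hi
    rw [hS]
    exact ⟨x, hx, hi⟩
  have hindep : ∀ i ∈ S, ∀ j ∈ S, ¬ G.Adj i j := by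
    intro i hi j hj
    rw [hS] at hi hj
    obtain ⟨x, hx, hxi⟩ := hi
    obtain ⟨y, hy, hyj⟩ := hj
    exact Matrix.not_adj_of_null_support hG hsym hpat hx hy hxi hyj
  set N : Set (Fin n) := {i | i ∉ S ∧ ∃ j ∈ S, G.Adj i j} with hN
  have hcomp : Nat.card (G.induce S).ConnectedComponent = Fintype.card S := by
    have hbot : G.induce S = ⊥ := by
      ext a b
      simpa using hindep a a.2 b b.2
    rw [hbot, SimpleGraph.card_connectedComponent_bot, Nat.card_eq_fintype_card]
  have hNcard : N.ncard = Fintype.card N := by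
    rw [← Nat.card_coe_set_eq, Nat.card_eq_fintype_card]
  let A : Matrix N S ℝ := M.submatrix Subtype.val Subtype.val
  have hker : LinearMap.ker M.mulVecLin =
      (LinearMap.ker A.mulVecLin).map (Function.ExtendByZero.linearMap ℝ Subtype.val) := by
    ext x
    simp only [Submodule.mem_map, LinearMap.mem_ker, Matrix.mulVecLin_apply]
    constructor
    · intro hx
      have hext := Matrix.extend_restrict_of_support_subset (hsupp hx)
      refine ⟨fun i => x i, ?_, hext⟩
      ext i
      have h := Matrix.mulVec_extend_zero M S (fun i => x i) i
      rw [hext, hx] at h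
      exact h.symm
    · rintro ⟨x, hx, rfl⟩
      ext i
      refine (Matrix.mulVec_extend_zero M S x i).trans ?_
      by_cases hi : i ∈ N
      · exact congrFun hx ⟨i, hi⟩
      · refine Finset.sum_eq_zero fun j _ => ?_
        have : M i j = 0 := by
          by_contra h
          have hij := (hpat i j).1 h
          exact hi ⟨fun hiS => hindep i hiS j j.2 hij, j, j.2, hij⟩
        rw [this, zero_mul]
  have hfin : Module.finrank ℝ (LinearMap.ker M.mulVecLin) =
      Module.finrank ℝ (LinearMap.ker A.mulVecLin) := by
    rw [hker]
    exact (Submodule.equivMapOfInjective _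
      (Function.extend_injective Subtype.val_injective (0 : Fin n → ℝ)) _).finrank_eq.symm
  have hrows : LinearIndependent ℝ A.row := by
    rw [← Matrix.vecMul_injective_iff, ← Matrix.coe_vecMulLinear,
      ← LinearMap.ker_eq_bot, LinearMap.ker_eq_bot']
    intro y hy
    ext ⟨i, hi⟩
    obtain ⟨hiS, j, hj, hij⟩ := hi
    obtain ⟨x, hx, hxj⟩ : ∃ x : Fin n → ℝ, M.mulVec x = 0 ∧ x j ≠ 0 := by rwa [hS] at hj
    have h := Matrix.mul_eq_zero_of_disjoint_support hG hsym hpat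
      (y := Function.extend Subtype.val y 0) hx
      (fun k hk => by
        rw [Matrix.mulVec_extend_zero]
        have h := congrFun hy ⟨k, hsupp hx k hk⟩
        simp only [Matrix.vecMulLinear_apply, Matrix.vecMul, dotProduct, Pi.zero_apply] at h
        rw [← h]
        refine Finset.sum_congr (by ext; simp) fun a _ => ?_
        rw [mul_comm, ← hsym.apply]
        rfl)
      (fun k hk => by
        rw [Function.extend_apply']
        · rfl
        · rintro ⟨a, rfl⟩
          exact a.2.1 (hsupp hx _ hk)) hij
    have h' := (mul_eq_zero.1 h).resolve_right hxj
    exact (Subtype.val_injective.extend_apply y 0 ⟨i, hiS, j, hj, hij⟩).symm.trans h'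
  have hrank : Module.finrank ℝ (LinearMap.range A.mulVecLin) = Fintype.card N :=
    hrows.rank_matrix
  have hnull := A.mulVecLin.finrank_range_add_finrank_ker
  rw [Module.finrank_fintype_fun_eq_card, hrank] at hnull
  rw [hfin, hcomp, hNcard, ← hnull]
  push_cast
  ring
end

section
/- Let G be a tree on the vertex set {1, …, n} and let M be a real symmetric n×n matrix with pattern G, i.e., for all indices i, j: M_{ij} ≠ 0 if and only if i and j are adjacent in G (in particular all diagonal entries of M are zero). Let λ be an eigenvalue of M and let supp(M, λ) be the set of indices i such that some vector x with M x = λ x has x_i ≠ 0. Then the dimension of the eigenspace {x : M x = λ x} equals the number of connected components of the induced subgraph G[supp(M, λ)] minus the number of indices not in supp(M, λ) that are adjacent in G to some index of supp(M, λ). -/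
open SimpleGraph

open scoped Classical

open Module

/-- In a tree, a vertex has at most one neighbour that is closer to the root `r`. -/
theorem SimpleGraph.IsTree.eq_of_adj_of_dist_eq_add_one {V : Type*} {G : SimpleGraph V}
    (hG : G.IsTree) {r v u w : V} (hu : G.Adj u v) (hw : G.Adj w v)
    (hdu : G.dist r v = G.dist r u + 1) (hdw : G.dist r v = G.dist r w + 1) : u = w := by
  obtain ⟨p, hp⟩ := hG.connected.exists_walk_length_eq_dist r u
  obtain ⟨q, hq⟩ := hG.connected.exists_walk_length_eq_dist r w
  have hp' : (p.concat hu).IsPath :=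
    Walk.isPath_of_length_eq_dist _ (by rw [Walk.length_concat, hp, hdu])
  have hq' : (q.concat hw).IsPath :=
    Walk.isPath_of_length_eq_dist _ (by rw [Walk.length_concat, hq, hdw])
  have h := congrArg Walk.penultimate ((hG.existsUnique_path r v).unique hp' hq')
  simpa using h

/-- If `j ∈ S` is the child of a vertex `i ∉ S`, every vertex of the component of `j` in `G[S]`
is either `j` or the child of a vertex of `S`, and it is at least as deep as `j`. -/
theorem SimpleGraph.IsTree.dist_le_of_reachable_induce {V : Type*} {G : SimpleGraph V}
    (hG : G.IsTree) (r : V) {S : Set V} {i : V} (hi : i ∉ S) {j v : S} (hij : G.Adj i j)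
    (hd : G.dist r j = G.dist r i + 1) (hv : (G.induce S).Reachable j v) :
    G.dist r j ≤ G.dist r v ∧
      (v = j ∨ ∃ u : S, G.Adj u v ∧ G.dist r v = G.dist r u + 1) := by
  let R : S → S → Prop := fun a b => G.Adj a b ∧ G.dist r b = G.dist r a + 1
  have key : ∀ {v : S}, (G.induce S).Walk v j → Relation.ReflTransGen R j v := by
    intro v p
    generalize hj' : j = j' at p
    induction p with
    | nil => subst hj'; exact .refl
    | @cons a b c hab p ih =>
      have hab' : G.Adj a b := hab
      have hb := ih hj'
      rcases hG.dist_eq_dist_add_one_of_adj r hab' with h | h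
      · exact hj' ▸ hb.tail ⟨hab'.symm, h⟩
      · rcases Relation.ReflTransGen.cases_tail hb with h' | ⟨e, he, hR⟩
        · subst hj'
          subst h'
          exact absurd (hG.eq_of_adj_of_dist_eq_add_one hab' hij h hd ▸ a.2) hi
        · have : e = a := Subtype.ext (hG.eq_of_adj_of_dist_eq_add_one hR.1 hab' hR.2 h)
          exact this ▸ he
  obtain ⟨p⟩ := hv.symm
  have hR := key p
  constructor
  · clear hv p
    induction hR with
    | refl => exact le_rfl
    | tail _ h ih => exact ih.trans (by have := h.2; omega)
  · rcases Relation.ReflTransGen.cases_tail hR with h | ⟨e, -, he⟩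
    · exact .inl h
    · exact .inr ⟨e, he⟩

section ComponentScaling

variable {V K : Type*} [Field K] {G : SimpleGraph V} {S : Set V}

/-- The vector equal to `z c * x v` at the vertices `v` of each component `c` of `G[S]`, and to
zero outside `S`. -/
noncomputable def componentScaling (G : SimpleGraph V) (S : Set V) (x : V → K) :
    ((G.induce S).ConnectedComponent → K) →ₗ[K] (V → K) where
  toFun z v := if h : v ∈ S then z ((G.induce S).connectedComponentMk ⟨v, h⟩) * x v else 0
  map_add' z w := by
    ext v
    by_cases h : v ∈ S <;> simp [h, add_mul]
  map_smul' c z := by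
    ext v
    by_cases h : v ∈ S <;> simp [h, mul_assoc]

theorem componentScaling_apply_mem (x : V → K) (z : (G.induce S).ConnectedComponent → K) {v : V}
    (h : v ∈ S) : componentScaling G S x z v =
      z ((G.induce S).connectedComponentMk ⟨v, h⟩) * x v := by
  simp [componentScaling, h]

theorem componentScaling_apply_notMem (x : V → K) (z : (G.induce S).ConnectedComponent → K)
    {v : V} (h : v ∉ S) : componentScaling G S x z v = 0 := by
  simp [componentScaling, h]

theorem componentScaling_injective {x : V → K} (hxS : ∀ v, x v ≠ 0 ↔ v ∈ S) :
    Function.Injective (componentScaling G S x) := by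
  intro z w hzw
  ext c
  induction c using ConnectedComponent.ind with
  | _ v =>
    have h := congrFun hzw v.1
    rw [componentScaling_apply_mem _ _ v.2, componentScaling_apply_mem _ _ v.2] at h
    exact mul_right_cancel₀ ((hxS v).2 v.2) h

end ComponentScaling

section TreePattern

variable {V K : Type*} [Fintype V] [Field K] {G : SimpleGraph V} {A : Matrix V V K} {S : Set V}

/-- If a kernel vector `x` has support `S`, every kernel vector supported in `S` is a multiple of
`x` along each edge of `G[S]`. -/
theorem div_eq_div_of_mulVec_eq_zero (hG : G.IsTree)
    (hA : ∀ i j, i ≠ j → (A i j ≠ 0 ↔ G.Adj i j)) {x y : V → K}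
    (hx : A.mulVec x = 0) (hxS : ∀ v, x v ≠ 0 ↔ v ∈ S)
    (hy : A.mulVec y = 0) (hyS : ∀ v, v ∉ S → y v = 0) {a b : V} (ha : a ∈ S) (hb : b ∈ S)
    (hab : G.Adj a b) : y a / x a = y b / x b := by
  let r := a
  let bad : Finset V :=
    {v | v ∈ S ∧ ∃ u ∈ S, G.Adj u v ∧ G.dist r v = G.dist r u + 1 ∧ y u / x u ≠ y v / x v}
  have hbad : bad = ∅ := by
    by_contra hne
    obtain ⟨v, hv, hmax⟩ := bad.exists_max_image (G.dist r) (Finset.nonempty_iff_ne_empty.2 hne)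
    simp only [bad, Finset.mem_filter, Finset.mem_univ, true_and] at hv hmax
    obtain ⟨hvS, u, huS, huv, hd, hne⟩ := hv
    have hsum : ∑ j, A v j * (y j - y v / x v * x j) = 0 := by
      have h1 := congrFun hx v
      have h2 := congrFun hy v
      simp only [Matrix.mulVec, dotProduct, Pi.zero_apply] at h1 h2
      have h3 : ∀ j, A v j * (y j - y v / x v * x j)
        = A v j * y j - y v / x v * (A v j * x j) := fun j => by ring
      simp only [h3, Finset.sum_sub_distrib, ← Finset.mul_sum, h1, h2, mul_zero, sub_zero]
    have hxv : x v ≠ 0 := (hxS v).2 hvS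
    have hxu : x u ≠ 0 := (hxS u).2 huS
    rw [Finset.sum_eq_single u] at hsum
    · rcases mul_eq_zero.1 hsum with h | h
      · exact (hA v u huv.ne').2 huv.symm h
      · exact hne (by rw [div_eq_iff hxu]; exact sub_eq_zero.1 h)
    · intro j _ hju
      by_cases hjv : j = v
      · subst hjv
        rw [div_mul_cancel₀ _ hxv, sub_self, mul_zero]
      by_cases hjS : j ∈ S
      · by_cases hvj : G.Adj v j
        · rcases hG.dist_eq_dist_add_one_of_adj r hvj with h | h
          · exact absurd (hG.eq_of_adj_of_dist_eq_add_one hvj.symm huv h hd) hju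
          · have hxj : x j ≠ 0 := (hxS j).2 hjS
            have heq : y v / x v = y j / x j := by
              by_contra hne'
              have := hmax j ⟨hjS, v, hvS, hvj, h, hne'⟩
              omega
            rw [heq, div_mul_cancel₀ _ hxj, sub_self, mul_zero]
        · rw [not_not.1 (mt (hA v j (Ne.symm hjv)).1 hvj), zero_mul]
      · rw [hyS j hjS, not_not.1 (mt (hxS j).1 hjS), mul_zero, sub_zero, mul_zero]
    · simp
  by_contra hne
  rcases hG.dist_eq_dist_add_one_of_adj r hab with h | h
  · have : a ∈ bad := by
      simpa [bad] using ⟨ha, b, hb, hab.symm, h, Ne.symm hne⟩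
    simp [hbad] at this
  · have : b ∈ bad := by
      simpa [bad] using ⟨hb, a, ha, hab, h, hne⟩
    simp [hbad] at this

/-- A kernel vector supported in `S` is a scaling of `x` on the components of `G[S]`. -/
theorem exists_componentScaling_eq (hG : G.IsTree)
    (hA : ∀ i j, i ≠ j → (A i j ≠ 0 ↔ G.Adj i j)) {x y : V → K}
    (hx : A.mulVec x = 0) (hxS : ∀ v, x v ≠ 0 ↔ v ∈ S)
    (hy : A.mulVec y = 0) (hyS : ∀ v, v ∉ S → y v = 0) :
    ∃ z, componentScaling G S x z = y := by
  refine ⟨ConnectedComponent.lift (fun v => y v / x v) ?_, ?_⟩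
  · intro v w p _
    induction p with
    | nil => rfl
    | @cons a b c hab p ih =>
      rename_i hp
      exact (div_eq_div_of_mulVec_eq_zero hG hA hx hxS hy hyS a.2 b.2 hab).trans
        (ih hp.of_cons)
  · ext v
    by_cases h : v ∈ S
    · rw [componentScaling_apply_mem _ _ h]
      exact div_mul_cancel₀ _ ((hxS v).2 h)
    · rw [componentScaling_apply_notMem _ _ h, hyS v h]

/-- Scaling the components of a kernel vector `x` with support `S` keeps the equations at all
vertices outside the boundary of `S`. -/
theorem mulVec_componentScaling_eq_zero
    (hA : ∀ i j, i ≠ j → (A i j ≠ 0 ↔ G.Adj i j)) {x : V → K}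
    (hx : A.mulVec x = 0) (hxS : ∀ v, x v ≠ 0 ↔ v ∈ S)
    (z : (G.induce S).ConnectedComponent → K) {v : V} (hv : v ∈ S ∨ ∀ j ∈ S, ¬ G.Adj v j) :
    A.mulVec (componentScaling G S x z) v = 0 := by
  by_cases h : v ∈ S
  · have h1 := congrFun hx v
    simp only [Matrix.mulVec, dotProduct, Pi.zero_apply] at h1 ⊢
    rw [← mul_zero (z ((G.induce S).connectedComponentMk ⟨v, h⟩)), ← h1, Finset.mul_sum]
    refine Finset.sum_congr rfl fun j _ => ?_
    by_cases hj : j ∈ S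
    · rw [componentScaling_apply_mem _ _ hj]
      by_cases hvj : v = j
      · subst hvj; ring
      by_cases hadj : G.Adj v j
      · have : (G.induce S).connectedComponentMk ⟨v, h⟩ =
            (G.induce S).connectedComponentMk ⟨j, hj⟩ :=
          ConnectedComponent.sound (Adj.reachable (by simpa using hadj))
        rw [this]; ring
      · rw [not_not.1 (mt (hA v j hvj).1 hadj)]; ring
    · rw [componentScaling_apply_notMem _ _ hj, not_not.1 (mt (hxS j).1 hj)]; ring
  · replace hv := hv.resolve_left h
    simp only [Matrix.mulVec, dotProduct]
    refine Finset.sum_eq_zero fun j _ => ?_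
    by_cases hj : j ∈ S
    · rw [not_not.1 (mt (hA v j (fun e => h (e ▸ hj))).1 (hv j hj)), zero_mul]
    · rw [componentScaling_apply_notMem _ _ hj, mul_zero]

/-- A boundary vertex has a child in `S`. -/
theorem exists_child_mem_of_adj (hG : G.IsTree) (r : V)
    (hA : ∀ i j, i ≠ j → (A i j ≠ 0 ↔ G.Adj i j)) {x : V → K}
    (hx : A.mulVec x = 0) (hxS : ∀ v, x v ≠ 0 ↔ v ∈ S) {i : V} (hi : i ∉ S)
    (hadj : ∃ j ∈ S, G.Adj i j) : ∃ j ∈ S, G.Adj i j ∧ G.dist r j = G.dist r i + 1 := by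
  by_contra! hno
  obtain ⟨j, hj, hij⟩ := hadj
  have h1 := congrFun hx i
  simp only [Matrix.mulVec, dotProduct, Pi.zero_apply] at h1
  have hdj : G.dist r i = G.dist r j + 1 :=
    (hG.dist_eq_dist_add_one_of_adj r hij).resolve_right (hno j hj hij)
  rw [Finset.sum_eq_single j] at h1
  · exact mul_ne_zero ((hA i j hij.ne).2 hij) ((hxS j).2 hj) h1
  · intro k _ hkj
    by_cases hk : k ∈ S
    · by_cases hik : G.Adj i k
      · have hdk := (hG.dist_eq_dist_add_one_of_adj r hik).resolve_right (hno k hk hik)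
        exact absurd (hG.eq_of_adj_of_dist_eq_add_one hik.symm hij.symm hdk hdj) hkj
      · rw [not_not.1 (mt (hA i k (fun e => hi (e ▸ hk))).1 hik), zero_mul]
    · rw [not_not.1 (mt (hxS k).1 hk), mul_zero]
  · simp

/-- The equations at the boundary of `S` are linearly independent on the scalings of the
components of `G[S]`. -/
theorem eq_zero_of_sum_mul_mulVec_componentScaling (hG : G.IsTree)
    (hA : ∀ i j, i ≠ j → (A i j ≠ 0 ↔ G.Adj i j)) {x : V → K}
    (hx : A.mulVec x = 0) (hxS : ∀ v, x v ≠ 0 ↔ v ∈ S)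
    (w : {i | i ∉ S ∧ ∃ j ∈ S, G.Adj i j} → K)
    (hw : ∀ z, ∑ i, w i * A.mulVec (componentScaling G S x z) i = 0) : w = 0 := by
  by_contra hne
  obtain ⟨r⟩ := hG.connected.nonempty
  have hne' : ({i | w i ≠ 0} : Finset _).Nonempty := by
    obtain ⟨i, hi⟩ := Function.ne_iff.1 hne
    exact ⟨i, by simpa using hi⟩
  obtain ⟨i, hi, hmax⟩ := Finset.exists_max_image _ (fun i => G.dist r i.1) hne'
  simp only [Finset.mem_filter, Finset.mem_univ, true_and] at hi hmax
  obtain ⟨j, hj, hij, hd⟩ := exists_child_mem_of_adj hG r hA hx hxS i.2.1 i.2.2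
  set c := (G.induce S).connectedComponentMk ⟨j, hj⟩ with hc
  have hsingle : ∀ v, v ∉ S ∨ (∀ h : v ∈ S, ¬ (G.induce S).Reachable ⟨j, hj⟩ ⟨v, h⟩) →
      componentScaling G S x (Pi.single c 1) v = 0 := by
    intro v hv
    by_cases h : v ∈ S
    · rw [componentScaling_apply_mem _ _ h, Pi.single_eq_of_ne, zero_mul]
      intro e
      exact (hv.resolve_left (not_not.2 h)) h (ConnectedComponent.exact e).symm
    · exact componentScaling_apply_notMem _ _ h
  have hz := hw (Pi.single c 1)
  have hzero : ∀ k : {i | i ∉ S ∧ ∃ j ∈ S, G.Adj i j}, ∀ v, (k ≠ i ∨ v ≠ j) →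
      w k * (A k v * componentScaling G S x (Pi.single c 1) v) = 0 := by
    intro k v hkv
    by_cases hwk : w k = 0
    · rw [hwk, zero_mul]
    by_cases hv : v ∈ S
    swap
    · rw [hsingle v (.inl hv), mul_zero, mul_zero]
    by_cases hr : (G.induce S).Reachable ⟨j, hj⟩ ⟨v, hv⟩
    swap
    · rw [hsingle v (.inr fun _ => hr), mul_zero, mul_zero]
    have hkv' : k.1 ≠ v := fun e => k.2.1 (e ▸ hv)
    by_cases hadj : G.Adj k v
    swap
    · rw [not_not.1 (mt (hA k v hkv').1 hadj), zero_mul, mul_zero]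
    exfalso
    have hki := hmax k hwk
    obtain ⟨hle, hpar⟩ := hG.dist_le_of_reachable_induce r i.2.1 (j := ⟨j, hj⟩) hij hd hr
    simp only at hle hpar
    have hdk : G.dist r v = G.dist r k + 1 := by
      rcases hG.dist_eq_dist_add_one_of_adj r hadj with h | h
      · omega
      · exact h
    rcases hpar with h | ⟨u, huv, hu⟩
    · have hvj : v = j := congrArg Subtype.val h
      subst hvj
      have := hG.eq_of_adj_of_dist_eq_add_one hadj hij hdk hd
      exact hkv.elim (fun h => h (Subtype.ext this)) (fun h => h rfl)
    · exact k.2.1 (hG.eq_of_adj_of_dist_eq_add_one huv hadj hu hdk ▸ u.2)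
  rw [Finset.sum_eq_single i] at hz
  · simp only [Matrix.mulVec, dotProduct] at hz
    rw [Finset.mul_sum, Finset.sum_eq_single j] at hz
    · rw [componentScaling_apply_mem _ _ hj, ← hc, Pi.single_eq_same, one_mul] at hz
      exact mul_ne_zero hi (mul_ne_zero ((hA i j hij.ne).2 hij) ((hxS j).2 hj)) hz
    · exact fun v _ hv => hzero i v (.inr hv)
    · simp
  · intro k _ hk
    simp only [Matrix.mulVec, dotProduct]
    rw [Finset.mul_sum]
    exact Finset.sum_eq_zero fun v _ => hzero k v (.inl hk)
  · simp

/-- The dimension of the kernel of a tree pattern matrix with arbitrary diagonal, in terms of its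
support. -/
theorem finrank_ker_add_ncard_boundary [Infinite K] (hG : G.IsTree)
    (hA : ∀ i j, i ≠ j → (A i j ≠ 0 ↔ G.Adj i j))
    (hS : S = {i | ∃ x : V → K, A.mulVec x = 0 ∧ x i ≠ 0}) :
    finrank K (LinearMap.ker A.mulVecLin) +
      ({i | i ∉ S ∧ ∃ j ∈ S, G.Adj i j} : Set V).ncard =
      Nat.card (G.induce S).ConnectedComponent := by
  have hyS : ∀ y, A.mulVec y = 0 → ∀ v, v ∉ S → y v = 0 := by
    intro y hy v hv
    by_contra h
    exact hv (hS ▸ ⟨y, hy, h⟩)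
  obtain ⟨x, hx, hxS'⟩ := Module.Dual.exists_forall_mem_ne_zero_of_forall_exists
    (LinearMap.ker A.mulVecLin) (fun v : S => (LinearMap.proj v.1 : (V → K) →ₗ[K] K)) (by
      rintro ⟨v, hv⟩
      rw [hS] at hv
      simpa using hv)
  replace hx : A.mulVec x = 0 := by simpa using hx
  have hxS : ∀ v, x v ≠ 0 ↔ v ∈ S :=
    fun v => ⟨fun h => by_contra fun hv => h (hyS x hx v hv), fun h => hxS' ⟨v, h⟩⟩
  let B : ((G.induce S).ConnectedComponent → K) →ₗ[K]
      ({i | i ∉ S ∧ ∃ j ∈ S, G.Adj i j} → K) :=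
    LinearMap.funLeft K K Subtype.val ∘ₗ A.mulVecLin ∘ₗ componentScaling G S x
  have hB : ∀ z i, B z i = A.mulVec (componentScaling G S x z) i.1 := fun _ _ => rfl
  have hker : LinearMap.ker A.mulVecLin = (LinearMap.ker B).map (componentScaling G S x) := by
    ext y
    simp only [LinearMap.mem_ker, Matrix.mulVecLin_apply, Submodule.mem_map]
    constructor
    · intro hy
      obtain ⟨z, hz⟩ := exists_componentScaling_eq hG hA hx hxS hy (hyS y hy)
      refine ⟨z, ?_, hz⟩
      ext i
      rw [hB, hz, hy]; rfl
    · rintro ⟨z, hz, rfl⟩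
      ext v
      by_cases hv : v ∉ S ∧ ∃ j ∈ S, G.Adj v j
      · exact congrFun hz ⟨v, hv⟩
      · refine mulVec_componentScaling_eq_zero hA hx hxS z ?_
        by_contra! h
        exact hv h
  have hsurj : LinearMap.range B = ⊤ := by
    by_contra hne
    obtain ⟨f, hf, hle⟩ := Submodule.exists_le_ker_of_lt_top _ (lt_top_iff_ne_top.2 hne)
    have hfsum : ∀ t, f t = ∑ i, f (Pi.single i 1) * t i := by
      intro t
      conv_lhs => rw [LinearMap.pi_apply_eq_sum_univ f t]
      exact Finset.sum_congr rfl fun i _ => by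
        rw [smul_eq_mul, mul_comm]
        congr 2
        ext j
        simp [Pi.single_apply, eq_comm]
    have h0 := eq_zero_of_sum_mul_mulVec_componentScaling hG hA hx hxS
      (fun i => f (Pi.single i 1)) fun z => by
        have := hle (LinearMap.mem_range_self B z)
        rw [LinearMap.mem_ker, hfsum] at this
        exact this
    apply hf
    refine LinearMap.ext fun t => ?_
    rw [hfsum]
    exact Finset.sum_eq_zero fun i _ => by rw [congrFun h0 i]; simp
  have hrn := LinearMap.finrank_range_add_finrank_ker B
  rw [hsurj, finrank_top, Module.finrank_fintype_fun_eq_card, Module.finrank_fintype_fun_eq_card]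
    at hrn
  rw [hker, ← LinearEquiv.finrank_eq
    (Submodule.equivMapOfInjective _ (componentScaling_injective hxS) (LinearMap.ker B)),
    ← Nat.card_coe_set_eq, Nat.card_eq_fintype_card, Nat.card_eq_fintype_card, add_comm]
  exact hrn

end TreePattern

theorem stmt_19 (n : ℕ) (G : SimpleGraph (Fin n)) (hT : G.IsTree)
    (M : Matrix (Fin n) (Fin n) ℝ) (hsym : M.IsSymm)
    (hpat : ∀ i j, M i j ≠ 0 ↔ G.Adj i j)
    (μ : ℝ) (hμ : ∃ x : Fin n → ℝ, x ≠ 0 ∧ M.mulVec x = μ • x)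
    (S : Set (Fin n)) (hS : S = {i | ∃ x : Fin n → ℝ, M.mulVec x = μ • x ∧ x i ≠ 0}) :
    (Module.finrank ℝ (LinearMap.ker (M.mulVecLin - μ • LinearMap.id)) : ℤ) =
      Nat.card (G.induce S).ConnectedComponent -
        ({i | i ∉ S ∧ ∃ j ∈ S, G.Adj i j} : Set (Fin n)).ncard := by
  have hmul : ∀ x, (M - μ • (1 : Matrix (Fin n) (Fin n) ℝ)).mulVec x = M.mulVec x - μ • x := by
    intro x
    rw [Matrix.sub_mulVec, Matrix.smul_mulVec, Matrix.one_mulVec]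
  have hlin : M.mulVecLin - μ • LinearMap.id =
      (M - μ • (1 : Matrix (Fin n) (Fin n) ℝ)).mulVecLin := by
    refine LinearMap.ext fun x => ?_
    rw [Matrix.mulVecLin_apply, hmul]
    rfl
  have h := finrank_ker_add_ncard_boundary (A := M - μ • (1 : Matrix (Fin n) (Fin n) ℝ)) (S := S)
    hT (fun i j hij => by simpa [Matrix.one_apply_ne hij] using hpat i j)
    (by simpa only [hmul, sub_eq_zero] using hS)
  rw [hlin, ← h]
  push_cast
  ring
end
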